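/- For every integer r ≥ 1 and every σ ≥ 1 there is a constant c > 0 depending only on r and σ such that the following inf-sup condition holds: for every σ-quasi-uniform rectangular partition P of Ω, every α : Ω → ℝ that is piecewise constant with respect to P with α ≥ α_0 > 0, and every nonzero v in the trial space U_P^r, there exists a test function w with |w|_{P'} > 0 and a_P(v, w) ≥ c · α_0 · |v|_1 · |w|_{P'}. -/

import Mathlib

open Polynomial MeasureTheory

noncomputable section

/-- `Leg r` is the `r`-th (formal) derivative of `(X² − 1)^r`, a nonzero scalar
multiple of the degree-`r` Legendre polynomial. -/
def Leg (r : ℕ) : Polynomial ℝ :=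
  (fun p => Polynomial.derivative p)^[r] ((Polynomial.X ^ 2 - 1) ^ r)

/-- `G 1 < … < G r` are the Gauss points: the roots of `Leg r`, all in `(-1,1)`. -/
def IsGaussPoints (r : ℕ) (G : ℕ → ℝ) : Prop :=
  (∀ k, 1 ≤ k → k < r → G k < G (k + 1)) ∧
  ∀ k, 1 ≤ k → k ≤ r → G k ∈ Set.Ioo (-1 : ℝ) 1 ∧ (Leg r).IsRoot (G k)

/-- `A k = ∫_{-1}^{1} ℓ_k` where `ℓ_k` is the Lagrange basis polynomial of degree
`≤ r - 1` at the Gauss points, i.e. `ℓ_k (G j) = δ_{jk}`. -/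
def IsGaussWeights (r : ℕ) (G A : ℕ → ℝ) : Prop :=
  ∀ k, 1 ≤ k → k ≤ r → ∃ ℓ : Polynomial ℝ,
    ℓ.natDegree ≤ r - 1 ∧
    (∀ j, 1 ≤ j → j ≤ r → ℓ.eval (G j) = if j = k then 1 else 0) ∧
    A k = ∫ x in (-1 : ℝ)..1, ℓ.eval x

/-- `Lob 0 = −1 < Lob 1 < … < Lob (r−1) < Lob r = 1` are the Lobatto points:
`±1` together with the roots of the derivative of `Leg r`. -/
def IsLobattoPoints (r : ℕ) (L : ℕ → ℝ) : Prop :=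
  L 0 = -1 ∧ L r = 1 ∧ (∀ k < r, L k < L (k + 1)) ∧
  ∀ k, 1 ≤ k → k + 1 ≤ r → L k ∈ Set.Ioo (-1 : ℝ) 1 ∧
    (Polynomial.derivative (Leg r)).IsRoot (L k)

/-- Cellwise partial derivative in the first (`x`) coordinate. -/
def pdx (f : ℝ × ℝ → ℝ) (z : ℝ × ℝ) : ℝ := fderiv ℝ f z (1, 0)

/-- Cellwise partial derivative in the second (`y`) coordinate. -/
def pdy (f : ℝ × ℝ → ℝ) (z : ℝ × ℝ) : ℝ := fderiv ℝ f z (0, 1)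

/-- A rectangular partition of `Ω = [a,b] × [c,d]`:
`a = x₀ < x₁ < … < x_m = b`, `c = y₀ < y₁ < … < y_n = d`. -/
structure RectPartition (a b c d : ℝ) where
  m : ℕ
  n : ℕ
  hm : 0 < m
  hn : 0 < n
  x : ℕ → ℝ
  y : ℕ → ℝ
  hxa : x 0 = a
  hxb : x m = b
  hyc : y 0 = c
  hyd : y n = d
  hxlt : ∀ i < m, x i < x (i + 1)
  hylt : ∀ j < n, y j < y (j + 1)

namespace RectPartition

variable {a b c d : ℝ}

/-- The domain `Ω = [a,b] × [c,d]`. -/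
def dom (_P : RectPartition a b c d) : Set (ℝ × ℝ) := Set.Icc a b ×ˢ Set.Icc c d

/-- The boundary `∂Ω`. -/
def bdry (P : RectPartition a b c d) : Set (ℝ × ℝ) :=
  P.dom \ (Set.Ioo a b ×ˢ Set.Ioo c d)

variable (P : RectPartition a b c d)

/-- Side length `h_i^x = x_i − x_{i−1}`. -/
def hx (i : ℕ) : ℝ := P.x i - P.x (i - 1)

/-- Side length `h_j^y = y_j − y_{j−1}`. -/
def hy (j : ℕ) : ℝ := P.y j - P.y (j - 1)

/-- The closed cell `τ_{i,j} = [x_{i−1}, x_i] × [y_{j−1}, y_j]`. -/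
def cell (i j : ℕ) : Set (ℝ × ℝ) :=
  Set.Icc (P.x (i - 1)) (P.x i) ×ˢ Set.Icc (P.y (j - 1)) (P.y j)

/-- The open cell `(x_{i−1}, x_i) × (y_{j−1}, y_j)`. -/
def openCell (i j : ℕ) : Set (ℝ × ℝ) :=
  Set.Ioo (P.x (i - 1)) (P.x i) ×ˢ Set.Ioo (P.y (j - 1)) (P.y j)

/-- The finite set of all side lengths of the partition. -/
def sides : Finset ℝ := ((Finset.Icc 1 P.m).image P.hx) ∪ ((Finset.Icc 1 P.n).image P.hy)

lemma sides_nonempty : P.sides.Nonempty :=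
  ⟨P.hx 1, Finset.mem_union_left _
    (Finset.mem_image_of_mem _ (Finset.mem_Icc.mpr ⟨le_rfl, P.hm⟩))⟩

/-- The mesh size `h`: the largest side length. -/
def meshSize : ℝ := P.sides.max' P.sides_nonempty

/-- `σ`-quasi-uniformity: every side length is at most `σ` times any other,
i.e. `h ≤ σ · min side`. -/
def QuasiUniform (σ : ℝ) : Prop := ∀ s ∈ P.sides, ∀ t ∈ P.sides, s ≤ σ * t

variable (r : ℕ) (G : ℕ → ℝ)

/-- The Gauss point `g^x_{i,k} = (x_i + x_{i−1} + h_i^x G_k)/2` for `1 ≤ k ≤ r`,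
with the conventions `g^x_{i,r+1} = g^x_{i+1,1}` (for `i < m`) and `g^x_{m,r+1} = b`. -/
def gx (i k : ℕ) : ℝ :=
  if k = r + 1 then
    (if i = P.m then P.x P.m
     else (P.x (i + 1) + P.x i + P.hx (i + 1) * G 1) / 2)
  else (P.x i + P.x (i - 1) + P.hx i * G k) / 2

/-- The Gauss point `g^y_{j,l}`, with the analogous conventions. -/
def gy (j l : ℕ) : ℝ :=
  if l = r + 1 then
    (if j = P.n then P.y P.n
     else (P.y (j + 1) + P.y j + P.hy (j + 1) * G 1) / 2)
  else (P.y j + P.y (j - 1) + P.hy j * G l) / 2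

end RectPartition

/-- A function on `Ω` which is piecewise smooth with respect to the partition:
a global function together with, for each cell, a (smooth) extension of its
restriction to the closed cell; cellwise derivatives are derivatives of the
cell functions. -/
structure PiecewiseFun {a b c d : ℝ} (P : RectPartition a b c d) where
  toFun : ℝ × ℝ → ℝ
  cellFun : ℕ → ℕ → ℝ × ℝ → ℝ
  agree : ∀ i ∈ Finset.Icc 1 P.m, ∀ j ∈ Finset.Icc 1 P.n, ∀ z ∈ P.cell i j,
    cellFun i j z = toFun z

namespace PiecewiseFun

variable {a b c d : ℝ} {P : RectPartition a b c d}

/-- Difference of two piecewise functions. -/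
def sub (u v : PiecewiseFun P) : PiecewiseFun P where
  toFun := fun z => u.toFun z - v.toFun z
  cellFun := fun i j z => u.cellFun i j z - v.cellFun i j z
  agree := fun i hi j hj z hz => by
    simp only [u.agree i hi j hj z hz, v.agree i hi j hj z hz]

end PiecewiseFun

/-- Cellwise `∂/∂x` of a piecewise function. -/
def cellDx {a b c d : ℝ} {P : RectPartition a b c d} (v : PiecewiseFun P) :
    ℕ → ℕ → ℝ × ℝ → ℝ := fun i j => pdx (v.cellFun i j)

/-- Cellwise `∂/∂y` of a piecewise function. -/
def cellDy {a b c d : ℝ} {P : RectPartition a b c d} (v : PiecewiseFun P) :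
    ℕ → ℕ → ℝ × ℝ → ℝ := fun i j => pdy (v.cellFun i j)

/-- `v` is `C^s` on each closed cell. -/
def CellSmooth {a b c d : ℝ} (P : RectPartition a b c d) (s : ℕ)
    (u : PiecewiseFun P) : Prop :=
  ∀ i ∈ Finset.Icc 1 P.m, ∀ j ∈ Finset.Icc 1 P.n, ContDiff ℝ s (u.cellFun i j)

/-- Evaluation of a bivariate polynomial (outer variable ↦ `x`, coefficients are
polynomials in `y`). -/
def evalXY (p : Polynomial (Polynomial ℝ)) (x y : ℝ) : ℝ :=
  (p.map (Polynomial.evalRingHom y)).eval x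

/-- `f` is (globally) a polynomial of degree `≤ r` in each of the two variables. -/
def IsBiPoly (r : ℕ) (f : ℝ × ℝ → ℝ) : Prop :=
  ∃ p : Polynomial (Polynomial ℝ), p.natDegree ≤ r ∧ (∀ k, (p.coeff k).natDegree ≤ r) ∧
    ∀ x y : ℝ, f (x, y) = evalXY p x y

/-- Membership in the trial space `U_P^r`: continuous on `Ω`, vanishing on `∂Ω`,
and a bi-degree `≤ r` polynomial on each cell. -/
def IsTrialFun {a b c d : ℝ} (r : ℕ) (P : RectPartition a b c d)
    (v : PiecewiseFun P) : Prop :=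
  ContinuousOn v.toFun P.dom ∧ (∀ z ∈ P.bdry, v.toFun z = 0) ∧
  ∀ i ∈ Finset.Icc 1 P.m, ∀ j ∈ Finset.Icc 1 P.n, IsBiPoly r (v.cellFun i j)

/-- The coefficients of a test function extended by the conventions
`w_{i,0;j,l} = w_{i−1,r;j,l}` (`0` if `i = 1`) and
`w_{i,k;j,0} = w_{i,k;j−1,r}` (`0` if `j = 1`). -/
def wE (r : ℕ) (w : ℕ → ℕ → ℕ → ℕ → ℝ) (i k j l : ℕ) : ℝ :=
  if (k = 0 ∧ i = 1) ∨ (l = 0 ∧ j = 1) then 0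
  else
    w (if k = 0 then i - 1 else i) (if k = 0 then r else k)
      (if l = 0 then j - 1 else j) (if l = 0 then r else l)

/-- The jump `[w]^x_{i,k;j,l} = w_{i,k;j,l} − w_{i,k−1;j,l}`. -/
def jumpX (r : ℕ) (w : ℕ → ℕ → ℕ → ℕ → ℝ) (i k j l : ℕ) : ℝ :=
  wE r w i k j l - wE r w i (k - 1) j l

/-- The jump `[w]^y_{i,k;j,l} = w_{i,k;j,l} − w_{i,k;j,l−1}`. -/
def jumpY (r : ℕ) (w : ℕ → ℕ → ℕ → ℕ → ℝ) (i k j l : ℕ) : ℝ :=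
  wE r w i k j l - wE r w i k j (l - 1)

/-- The double jump `⌊w⌋_{i,k;j,l}`. -/
def jumpXY (r : ℕ) (w : ℕ → ℕ → ℕ → ℕ → ℝ) (i k j l : ℕ) : ℝ :=
  wE r w i k j l - wE r w i (k - 1) j l - wE r w i k j (l - 1) + wE r w i (k - 1) j (l - 1)

/-- A test function: coefficients `w_{i,k;j,l}`, `1 ≤ i ≤ m`, `1 ≤ k ≤ r`,
`1 ≤ j ≤ n`, `1 ≤ l ≤ r`, vanishing for `(i,k) = (m,r)` or `(j,l) = (n,r)`. -/
def IsTestFun {a b c d : ℝ} (r : ℕ) (P : RectPartition a b c d)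
    (w : ℕ → ℕ → ℕ → ℕ → ℝ) : Prop :=
  (∀ j ∈ Finset.Icc 1 P.n, ∀ l ∈ Finset.Icc 1 r, w P.m r j l = 0) ∧
  (∀ i ∈ Finset.Icc 1 P.m, ∀ k ∈ Finset.Icc 1 r, w i k P.n r = 0)

/-- The index set `X`: quadruples `(i,k,j,l)` with `(j,l) ≠ (n,r)`. -/
def idxX {a b c d : ℝ} (r : ℕ) (P : RectPartition a b c d) : Finset (ℕ × ℕ × ℕ × ℕ) :=
  (Finset.Icc 1 P.m ×ˢ Finset.Icc 1 r ×ˢ Finset.Icc 1 P.n ×ˢ Finset.Icc 1 r).filter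
    fun q => ¬(q.2.2.1 = P.n ∧ q.2.2.2 = r)

/-- The index set `Y`: quadruples `(i,k,j,l)` with `(i,k) ≠ (m,r)`. -/
def idxY {a b c d : ℝ} (r : ℕ) (P : RectPartition a b c d) : Finset (ℕ × ℕ × ℕ × ℕ) :=
  (Finset.Icc 1 P.m ×ˢ Finset.Icc 1 r ×ˢ Finset.Icc 1 P.n ×ˢ Finset.Icc 1 r).filter
    fun q => ¬(q.1 = P.m ∧ q.2.1 = r)

/-- The index set of interior dual volumes: `(i,k) ≠ (m,r)` and `(j,l) ≠ (n,r)`. -/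
def idxZ {a b c d : ℝ} (r : ℕ) (P : RectPartition a b c d) : Finset (ℕ × ℕ × ℕ × ℕ) :=
  (Finset.Icc 1 P.m ×ˢ Finset.Icc 1 r ×ˢ Finset.Icc 1 P.n ×ˢ Finset.Icc 1 r).filter
    fun q => ¬(q.1 = P.m ∧ q.2.1 = r) ∧ ¬(q.2.2.1 = P.n ∧ q.2.2.2 = r)

/-- The dual-mesh seminorm `|w|_{P'}`. -/
def dualSemi {a b c d : ℝ} (r : ℕ) (P : RectPartition a b c d)
    (w : ℕ → ℕ → ℕ → ℕ → ℝ) : ℝ :=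
  Real.sqrt
    ((∑ q ∈ idxX r P, (jumpX r w q.1 q.2.1 q.2.2.1 q.2.2.2) ^ 2) +
     (∑ q ∈ idxY r P, (jumpY r w q.1 q.2.1 q.2.2.1 q.2.2.2) ^ 2))

/-- The FVM bilinear form `a_P(v, w)`, with the cellwise derivatives of `v`
given by `Dxv i j` and `Dyv i j` on cell `(i,j)`.  The integrals along Gauss
lines are split at the cell interfaces `y = y_j` (resp. `x = x_i`), which only
matters for the last Gauss subinterval `l = r` (resp. `k = r`). -/
def aP {a b c d : ℝ} (r : ℕ) (G : ℕ → ℝ) (P : RectPartition a b c d)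
    (α : ℝ × ℝ → ℝ) (Dxv Dyv : ℕ → ℕ → ℝ × ℝ → ℝ) (w : ℕ → ℕ → ℕ → ℕ → ℝ) : ℝ :=
  (∑ q ∈ idxX r P,
    jumpX r w q.1 q.2.1 q.2.2.1 q.2.2.2 *
      ((∫ t in (P.gy r G q.2.2.1 q.2.2.2)..(min (P.gy r G q.2.2.1 (q.2.2.2 + 1)) (P.y q.2.2.1)),
          α (P.gx r G q.1 q.2.1, t) * Dxv q.1 q.2.2.1 (P.gx r G q.1 q.2.1, t)) +
       (∫ t in (P.y q.2.2.1)..(max (P.gy r G q.2.2.1 (q.2.2.2 + 1)) (P.y q.2.2.1)),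
          α (P.gx r G q.1 q.2.1, t) * Dxv q.1 (q.2.2.1 + 1) (P.gx r G q.1 q.2.1, t)))) +
  (∑ q ∈ idxY r P,
    jumpY r w q.1 q.2.1 q.2.2.1 q.2.2.2 *
      ((∫ t in (P.gx r G q.1 q.2.1)..(min (P.gx r G q.1 (q.2.1 + 1)) (P.x q.1)),
          α (t, P.gy r G q.2.2.1 q.2.2.2) * Dyv q.1 q.2.2.1 (t, P.gy r G q.2.2.1 q.2.2.2)) +
       (∫ t in (P.x q.1)..(max (P.gx r G q.1 (q.2.1 + 1)) (P.x q.1)),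
          α (t, P.gy r G q.2.2.1 q.2.2.2) * Dyv (q.1 + 1) q.2.2.1 (t, P.gy r G q.2.2.1 q.2.2.2))))

/-- The broken `H¹` seminorm `|v|₁` computed cellwise. -/
def semiH1 {a b c d : ℝ} (P : RectPartition a b c d) (v : PiecewiseFun P) : ℝ :=
  Real.sqrt (∑ i ∈ Finset.Icc 1 P.m, ∑ j ∈ Finset.Icc 1 P.n,
    ∫ z in P.cell i j, ((cellDx v i j z) ^ 2 + (cellDy v i j z) ^ 2))

/-- The mesh-dependent seminorm `|v|_P` (broken `H²`-type seminorm). -/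
def semiP {a b c d : ℝ} (P : RectPartition a b c d) (v : PiecewiseFun P) : ℝ :=
  Real.sqrt (∑ i ∈ Finset.Icc 1 P.m, ∑ j ∈ Finset.Icc 1 P.n,
    ((∫ z in P.cell i j, ((cellDx v i j z) ^ 2 + (cellDy v i j z) ^ 2)) +
      (P.hx i ^ 2 + P.hy j ^ 2) *
        ∫ z in P.cell i j,
          ((pdx (pdx (v.cellFun i j)) z) ^ 2 + 2 * (pdy (pdx (v.cellFun i j)) z) ^ 2 +
            (pdy (pdy (v.cellFun i j)) z) ^ 2)))

/-- The broken seminorm `|u|_{s,P}`. -/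
def brokenSemi {a b c d : ℝ} (P : RectPartition a b c d) (u : PiecewiseFun P) (s : ℕ) : ℝ :=
  Real.sqrt (∑ i ∈ Finset.Icc 1 P.m, ∑ j ∈ Finset.Icc 1 P.n, ∑ t ∈ Finset.range (s + 1),
    ∫ z in P.cell i j, (pdx^[t] (pdy^[s - t] (u.cellFun i j)) z) ^ 2)

/-- The broken norm `‖u‖_{s,P} = (Σ_{t=0}^{s} |u|_{t,P}²)^{1/2}`. -/
def brokenNorm {a b c d : ℝ} (P : RectPartition a b c d) (u : PiecewiseFun P) (s : ℕ) : ℝ :=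
  Real.sqrt (∑ t ∈ Finset.range (s + 1), (brokenSemi P u t) ^ 2)

/-- `w = Πv`: the test function determined by the double-jump constraints
`⌊Πv⌋_{i,k;j,l} = A^x_{i,k} A^y_{j,l} ∂²v/∂x∂y(g^x_{i,k}, g^y_{j,l})`. -/
def IsPiOf {a b c d : ℝ} (r : ℕ) (G A : ℕ → ℝ) (P : RectPartition a b c d)
    (v : PiecewiseFun P) (w : ℕ → ℕ → ℕ → ℕ → ℝ) : Prop :=
  IsTestFun r P w ∧
  ∀ i ∈ Finset.Icc 1 P.m, ∀ k ∈ Finset.Icc 1 r, ∀ j ∈ Finset.Icc 1 P.n, ∀ l ∈ Finset.Icc 1 r,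
    ¬(i = P.m ∧ k = r) → ¬(j = P.n ∧ l = r) →
    jumpXY r w i k j l =
      (P.hx i * A k / 2) * (P.hy j * A l / 2) *
        pdy (pdx (v.cellFun i j)) (P.gx r G i k, P.gy r G j l)

/-- `α` is piecewise constant with respect to `P`. -/
def PiecewiseConstant {a b c d : ℝ} (P : RectPartition a b c d) (α : ℝ × ℝ → ℝ) : Prop :=
  ∀ i ∈ Finset.Icc 1 P.m, ∀ j ∈ Finset.Icc 1 P.n, ∃ cst : ℝ, ∀ z ∈ P.openCell i j, α z = cst

/-- The cellwise fluxes `α ∂u/∂x`, `α ∂u/∂y` extend continuously to `Ω`. -/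
def FluxContinuous {a b c d : ℝ} (P : RectPartition a b c d) (α : ℝ × ℝ → ℝ)
    (u : PiecewiseFun P) : Prop :=
  ∃ Fx Fy : ℝ × ℝ → ℝ, ContinuousOn Fx P.dom ∧ ContinuousOn Fy P.dom ∧
    ∀ i ∈ Finset.Icc 1 P.m, ∀ j ∈ Finset.Icc 1 P.n, ∀ z ∈ P.openCell i j,
      Fx z = α z * cellDx u i j z ∧ Fy z = α z * cellDy u i j z

/-- The iterated integral of `f` over the rectangle `[x₁,x₂] × [y₁,y₂]`. -/
def rectInt (f : ℝ × ℝ → ℝ) (x₁ x₂ y₁ y₂ : ℝ) : ℝ :=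
  ∫ s in x₁..x₂, ∫ t in y₁..y₂, f (s, t)

/-- The integral over the dual volume `τ'_{i,k;j,l} = [g^x_{i,k}, g^x_{i,k+1}] ×
[g^y_{j,l}, g^y_{j,l+1}]` of a cellwise-defined integrand `F i j`, split along
the cell interfaces `x = x_i` and `y = y_j`. -/
def dualCellInt {a b c d : ℝ} (r : ℕ) (G : ℕ → ℝ) (P : RectPartition a b c d)
    (F : ℕ → ℕ → ℝ × ℝ → ℝ) (i k j l : ℕ) : ℝ :=
  rectInt (F i j) (P.gx r G i k) (min (P.gx r G i (k + 1)) (P.x i))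
    (P.gy r G j l) (min (P.gy r G j (l + 1)) (P.y j)) +
  rectInt (F (i + 1) j) (P.x i) (max (P.gx r G i (k + 1)) (P.x i))
    (P.gy r G j l) (min (P.gy r G j (l + 1)) (P.y j)) +
  rectInt (F i (j + 1)) (P.gx r G i k) (min (P.gx r G i (k + 1)) (P.x i))
    (P.y j) (max (P.gy r G j (l + 1)) (P.y j)) +
  rectInt (F (i + 1) (j + 1)) (P.x i) (max (P.gx r G i (k + 1)) (P.x i))
    (P.y j) (max (P.gy r G j (l + 1)) (P.y j))

/-- The cellwise source term `f = −α (∂²u/∂x² + ∂²u/∂y²)` (for piecewise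
constant `α`). -/
def cellSource {a b c d : ℝ} {P : RectPartition a b c d} (α : ℝ × ℝ → ℝ)
    (u : PiecewiseFun P) (i j : ℕ) (z : ℝ × ℝ) : ℝ :=
  -(α z * (pdx (pdx (u.cellFun i j)) z + pdy (pdy (u.cellFun i j)) z))

/-- The right-hand side `Σ w_{i,k;j,l} ∫_{τ'_{i,k;j,l}} f` of the FV scheme. -/
def fvRHS {a b c d : ℝ} (r : ℕ) (G : ℕ → ℝ) (P : RectPartition a b c d)
    (α : ℝ × ℝ → ℝ) (u : PiecewiseFun P) (w : ℕ → ℕ → ℕ → ℕ → ℝ) : ℝ :=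
  ∑ q ∈ idxZ r P, w q.1 q.2.1 q.2.2.1 q.2.2.2 *
    dualCellInt r G P (cellSource α u) q.1 q.2.1 q.2.2.1 q.2.2.2

/-- `uP` is a finite volume solution for the exact solution `u`. -/
def IsFVSolution {a b c d : ℝ} (r : ℕ) (G : ℕ → ℝ) (P : RectPartition a b c d)
    (α : ℝ × ℝ → ℝ) (u uP : PiecewiseFun P) : Prop :=
  IsTrialFun r P uP ∧
  ∀ w, IsTestFun r P w → aP r G P α (cellDx uP) (cellDy uP) w = fvRHS r G P α u w

/-- The Lobatto node in cell `(i,j)` with 0-based indices `0 ≤ k, l ≤ r`. -/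
def lobattoNode {a b c d : ℝ} (P : RectPartition a b c d) (L : ℕ → ℝ)
    (i j k l : ℕ) : ℝ × ℝ :=
  ((P.x (i - 1) + P.x i + P.hx i * L k) / 2, (P.y (j - 1) + P.y j + P.hy j * L l) / 2)

/-- `uI` is the Lobatto interpolant of `u` in the trial space `U_P^r`. -/
def IsLobattoInterp {a b c d : ℝ} (r : ℕ) (L : ℕ → ℝ) (P : RectPartition a b c d)
    (u : ℝ × ℝ → ℝ) (uI : PiecewiseFun P) : Prop :=
  IsTrialFun r P uI ∧
  ∀ i ∈ Finset.Icc 1 P.m, ∀ j ∈ Finset.Icc 1 P.n,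
    ∀ k ∈ Finset.Icc 0 r, ∀ l ∈ Finset.Icc 0 r,
      uI.toFun (lobattoNode P L i j k l) = u (lobattoNode P L i j k l)

/-- The piecewise oscillation `osc_P(α)`: the maximum over all cells of
`ess sup α − ess inf α`. -/
def oscP {a b c d : ℝ} (P : RectPartition a b c d) (α : ℝ × ℝ → ℝ) : ℝ :=
  (Finset.Icc 1 P.m ×ˢ Finset.Icc 1 P.n).sup'
    (Finset.Nonempty.product (Finset.nonempty_Icc.mpr P.hm) (Finset.nonempty_Icc.mpr P.hn))
    fun p => essSup α (volume.restrict (P.cell p.1 p.2)) -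
      essInf α (volume.restrict (P.cell p.1 p.2))

end

/-! ### Gauss quadrature on the reference interval -/

lemma Polynomial.intervalIntegrable_eval (p : ℝ[X]) (a b : ℝ) :
    IntervalIntegrable (fun x => p.eval x) volume a b :=
  p.continuous.intervalIntegrable a b

lemma Polynomial.integral_eval_derivative (p : ℝ[X]) (a b : ℝ) :
    ∫ x in a..b, (derivative p).eval x = p.eval b - p.eval a :=
  intervalIntegral.integral_eq_sub_of_hasDerivAt (fun x _ => p.hasDerivAt x)
    ((derivative p).intervalIntegrable_eval a b)

lemma Polynomial.exists_derivative_eq (p : ℝ[X]) :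
    ∃ q : ℝ[X], derivative q = p ∧ q.natDegree ≤ p.natDegree + 1 := by
  refine ⟨∑ i ∈ Finset.range (p.natDegree + 1), monomial (i + 1) (p.coeff i / (i + 1)), ?_, ?_⟩
  · rw [derivative_sum]
    conv_rhs => rw [p.as_sum_range]
    refine Finset.sum_congr rfl fun i _ => ?_
    rw [derivative_monomial]
    have : ((i : ℝ) + 1) ≠ 0 := by positivity
    simp [this]
  · refine natDegree_sum_le_of_forall_le _ _ fun i hi => ?_
    refine (natDegree_monomial_le _).trans ?_
    have := Finset.mem_range.mp hi
    omega

lemma integral_iterate_derivative_mul_eq_zero (f : ℝ[X]) (n : ℕ)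
    (hf : ∀ j < n, (derivative^[j] f).eval 1 = 0 ∧ (derivative^[j] f).eval (-1) = 0) :
    ∀ q : ℝ[X], q.degree < n →
      ∫ x in (-1 : ℝ)..1, (derivative^[n] f * q).eval x = 0 := by
  induction n with
  | zero =>
    intro q hq
    have : q = 0 := by
      rw [← degree_eq_bot]
      simpa using hq
    simp [this]
  | succ n ih =>
    intro q hq
    have hq' : (derivative q).degree < n := by
      by_cases h0 : q = 0
      · simp [h0]
      · have h1 := degree_derivative_lt h0
        have h2 : q.degree ≤ n := by
          rw [← natDegree_lt_iff_degree_lt h0] at hq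
          exact degree_le_of_natDegree_le (by omega)
        exact lt_of_lt_of_le h1 h2
    have key := Polynomial.integral_eval_derivative (derivative^[n] f * q) (-1) 1
    have hI := ih (fun j hj => hf j (by omega)) _ hq'
    rw [derivative_mul] at key
    simp only [eval_add] at key
    rw [intervalIntegral.integral_add (Polynomial.intervalIntegrable_eval _ _ _)
      (Polynomial.intervalIntegrable_eval _ _ _), hI, eval_mul, eval_mul,
      (hf n (by omega)).1, (hf n (by omega)).2] at key
    rw [Function.iterate_succ_apply']
    linarith

lemma Leg_integral_mul_eq_zero (r : ℕ) (q : ℝ[X]) (hq : q.degree < r) :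
    ∫ x in (-1 : ℝ)..1, (Leg r * q).eval x = 0 := by
  refine integral_iterate_derivative_mul_eq_zero _ r (fun j hj => ?_) q hq
  have h : (X ^ 2 - 1 : ℝ[X]) ∣ derivative^[j] ((X ^ 2 - 1) ^ r) :=
    (dvd_pow_self _ (by omega : r - j ≠ 0)).trans
      (pow_sub_dvd_iterate_derivative_of_pow_dvd j (dvd_refl _))
  obtain ⟨s, hs⟩ := h
  rw [hs]
  simp

lemma Leg_coeff_ne_zero (r : ℕ) : (Leg r).coeff r ≠ 0 := by
  have h : ((X ^ 2 - 1 : ℝ[X]) ^ r).coeff (r + r) = 1 := by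
    have hm : (X ^ 2 - 1 : ℝ[X]).Monic := by
      simpa using monic_X_pow_sub_C (1 : ℝ) (two_ne_zero)
    have hd : (X ^ 2 - 1 : ℝ[X]).natDegree = 2 := by
      simpa using natDegree_X_pow_sub_C (n := 2) (r := (1 : ℝ))
    have := (hm.pow r).coeff_natDegree
    rwa [hm.natDegree_pow, hd, mul_two] at this
  change (derivative^[r] ((X ^ 2 - 1 : ℝ[X]) ^ r)).coeff r ≠ 0
  rw [coeff_iterate_derivative, h]
  have : (r + r).descFactorial r ≠ 0 := by
    rw [Ne, Nat.descFactorial_eq_zero_iff_lt]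
    omega
  simp [this]

lemma Leg_natDegree (r : ℕ) : (Leg r).natDegree = r := by
  refine natDegree_eq_of_le_of_coeff_ne_zero ?_ (Leg_coeff_ne_zero r)
  change (derivative^[r] ((X ^ 2 - 1 : ℝ[X]) ^ r)).natDegree ≤ r
  refine (natDegree_iterate_derivative _ _).trans ?_
  have hd : (X ^ 2 - 1 : ℝ[X]).natDegree = 2 := by
    simpa using natDegree_X_pow_sub_C (n := 2) (r := (1 : ℝ))
  rw [natDegree_pow, hd]
  omega

lemma Leg_ne_zero (r : ℕ) : Leg r ≠ 0 := fun h => Leg_coeff_ne_zero r (by simp [h])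

section Gauss

variable {r : ℕ} {G A : ℕ → ℝ}

lemma IsGaussPoints.lt (hG : IsGaussPoints r G) {k l : ℕ} (hk : 1 ≤ k) (hkl : k < l)
    (hl : l ≤ r) : G k < G l := by
  induction l, hkl using Nat.le_induction with
  | base => exact hG.1 k hk (by omega)
  | succ l hl' ih => exact (ih (by omega)).trans (hG.1 l (by omega) (by omega))

lemma IsGaussPoints.injOn (hG : IsGaussPoints r G) :
    Set.InjOn G (Finset.Icc 1 r : Finset ℕ) := by
  intro k hk l hl h
  simp only [Finset.coe_Icc, Set.mem_Icc] at hk hl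
  rcases lt_trichotomy k l with h' | h' | h'
  · exact absurd h (hG.lt hk.1 h' hl.2).ne
  · exact h'
  · exact absurd h (hG.lt hl.1 h' hk.2).ne'

lemma gauss_exact_of_degree_lt (hG : IsGaussPoints r G) (hA : IsGaussWeights r G A)
    (p : ℝ[X]) (hp : p.degree < r) :
    ∫ x in (-1 : ℝ)..1, p.eval x = ∑ k ∈ Finset.Icc 1 r, A k * p.eval (G k) := by
  choose! ℓ hd he hA' using hA
  have hr : p ≠ 0 → 1 ≤ r := fun h0 => by
    rw [← natDegree_lt_iff_degree_lt h0] at hp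
    omega
  by_cases h0 : p = 0
  · simp [h0]
  replace hr := hr h0
  have hpe : p = ∑ k ∈ Finset.Icc 1 r, C (p.eval (G k)) * ℓ k := by
    refine eq_of_degrees_lt_of_eval_index_eq (Finset.Icc 1 r) hG.injOn (by simpa using hp) ?_ ?_
    · refine lt_of_le_of_lt (b := ((r - 1 : ℕ) : WithBot ℕ)) ?_ ?_
      · refine degree_le_of_natDegree_le (natDegree_sum_le_of_forall_le _ _ fun k hk => ?_)
        rw [Finset.mem_Icc] at hk
        exact (natDegree_C_mul_le _ _).trans (hd k hk.1 hk.2)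
      · simp only [Nat.card_Icc]
        exact_mod_cast (by omega : r - 1 < r + 1 - 1)
    · intro j hj
      rw [eval_finsetSum, Finset.sum_eq_single_of_mem j hj]
      · rw [Finset.mem_Icc] at hj
        simp [he j hj.1 hj.2 j hj.1 hj.2]
      · intro k hk hkj
        rw [Finset.mem_Icc] at hj hk
        simp [he k hk.1 hk.2 j hj.1 hj.2, hkj.symm]
  conv_lhs => rw [hpe]
  simp only [eval_finsetSum, eval_mul, eval_C]
  rw [intervalIntegral.integral_finsetSum
    (fun k _ => ((ℓ k).intervalIntegrable_eval _ _).const_mul _)]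
  refine Finset.sum_congr rfl fun k hk => ?_
  rw [Finset.mem_Icc] at hk
  rw [intervalIntegral.integral_const_mul, hA' k hk.1 hk.2, mul_comm]

/-- Gauss quadrature is exact up to degree `2r - 1`. -/
lemma gauss_exact (hG : IsGaussPoints r G) (hA : IsGaussWeights r G A)
    (p : ℝ[X]) (hp : p.degree < (2 * r : ℕ)) :
    ∫ x in (-1 : ℝ)..1, p.eval x = ∑ k ∈ Finset.Icc 1 r, A k * p.eval (G k) := by
  have hLd : (Leg r).degree = r := by rw [degree_eq_natDegree (Leg_ne_zero r), Leg_natDegree]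
  have hdiv := EuclideanDomain.div_add_mod p (Leg r)
  have hmod : (p % Leg r).degree < r := by
    have := EuclideanDomain.mod_lt p (Leg_ne_zero r)
    rw [← hLd]
    exact this
  have hq : (p / Leg r).degree < r := by
    by_cases h0 : p / Leg r = 0
    · rw [h0]
      simp
    · have h1 : (Leg r * (p / Leg r)).degree < (2 * r : ℕ) := by
        rw [eq_sub_of_add_eq hdiv]
        refine (degree_sub_le _ _).trans_lt (max_lt hp (hmod.trans_le ?_))
        exact_mod_cast (by omega : r ≤ 2 * r)
      rw [← natDegree_lt_iff_degree_lt (mul_ne_zero (Leg_ne_zero r) h0),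
        natDegree_mul (Leg_ne_zero r) h0, Leg_natDegree] at h1
      rw [← natDegree_lt_iff_degree_lt h0]
      omega
  have hev : ∀ x, p.eval x = (Leg r * (p / Leg r)).eval x + (p % Leg r).eval x := fun x => by
    rw [← eval_add, hdiv]
  simp_rw [hev]
  rw [intervalIntegral.integral_add (intervalIntegrable_eval _ _ _)
    (intervalIntegrable_eval _ _ _), Leg_integral_mul_eq_zero r _ hq, zero_add,
    gauss_exact_of_degree_lt hG hA _ hmod]
  refine Finset.sum_congr rfl fun k hk => ?_
  rw [Finset.mem_Icc] at hk
  rw [eval_mul, (hG.2 k hk.1 hk.2).2.eq_zero, zero_mul, zero_add]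

/-- In degree `2r` Gauss quadrature underestimates when the leading coefficient is nonnegative. -/
lemma gauss_le_integral (hG : IsGaussPoints r G) (hA : IsGaussWeights r G A)
    (p : ℝ[X]) (hp : p.natDegree ≤ 2 * r) (hc : 0 ≤ p.coeff (2 * r)) :
    ∑ k ∈ Finset.Icc 1 r, A k * p.eval (G k) ≤ ∫ x in (-1 : ℝ)..1, p.eval x := by
  set e := p.coeff (2 * r) / (Leg r).coeff r ^ 2 with he
  have he0 : 0 ≤ e := div_nonneg hc (sq_nonneg _)
  have hL := Leg_coeff_ne_zero r
  set s := p - C e * (Leg r * Leg r) with hs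
  have hLL : (Leg r * Leg r).coeff (2 * r) = (Leg r).coeff r ^ 2 := by
    rw [two_mul, coeff_mul_add_eq_of_natDegree_le (Leg_natDegree r).le (Leg_natDegree r).le, sq]
  have hLLd : (C e * (Leg r * Leg r)).natDegree ≤ 2 * r := by
    refine (natDegree_C_mul_le _ _).trans (natDegree_mul_le.trans ?_)
    rw [Leg_natDegree]
    omega
  have hsd : s.degree < (2 * r : ℕ) := by
    rw [degree_lt_iff_coeff_zero]
    intro m hm
    rcases hm.eq_or_lt with rfl | hm
    · rw [hs, coeff_sub, coeff_C_mul, hLL, he]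
      field_simp
      simp
    · rw [hs, coeff_sub, coeff_eq_zero_of_natDegree_lt (hp.trans_lt hm),
        coeff_eq_zero_of_natDegree_lt (hLLd.trans_lt hm), sub_zero]
  have hev : ∀ x, p.eval x = e * (Leg r).eval x ^ 2 + s.eval x := fun x => by
    rw [hs]
    simp
    ring
  have hintegral : ∫ x in (-1 : ℝ)..1, p.eval x =
      e * (∫ x in (-1 : ℝ)..1, (Leg r).eval x ^ 2) + ∫ x in (-1 : ℝ)..1, s.eval x := by
    simp_rw [hev]
    rw [intervalIntegral.integral_add, intervalIntegral.integral_const_mul]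
    · exact Continuous.intervalIntegrable (by fun_prop) _ _
    · exact intervalIntegrable_eval _ _ _
  have hnn : 0 ≤ ∫ x in (-1 : ℝ)..1, (Leg r).eval x ^ 2 :=
    intervalIntegral.integral_nonneg (by norm_num) fun x _ => sq_nonneg _
  rw [hintegral, gauss_exact hG hA s hsd]
  have : ∑ k ∈ Finset.Icc 1 r, A k * p.eval (G k) =
      ∑ k ∈ Finset.Icc 1 r, A k * s.eval (G k) := by
    refine Finset.sum_congr rfl fun k hk => ?_
    rw [Finset.mem_Icc] at hk
    rw [hev, (hG.2 k hk.1 hk.2).2.eq_zero]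
    simp
  rw [this]
  nlinarith [mul_nonneg he0 hnn]

lemma gauss_weight_nonneg (hr : 1 ≤ r) (hG : IsGaussPoints r G) (hA : IsGaussWeights r G A)
    {k : ℕ} (hk : k ∈ Finset.Icc 1 r) : 0 ≤ A k := by
  have hk' := Finset.mem_Icc.mp hk
  obtain ⟨ℓ, hd, he, -⟩ := hA k hk'.1 hk'.2
  have hdeg : (ℓ * ℓ).degree < (2 * r : ℕ) := by
    refine lt_of_le_of_lt (degree_le_of_natDegree_le (natDegree_mul_le (p := ℓ) (q := ℓ))) ?_
    exact_mod_cast (by omega : ℓ.natDegree + ℓ.natDegree < 2 * r)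
  have h := gauss_exact hG hA _ hdeg
  rw [Finset.sum_eq_single_of_mem k hk] at h
  · rw [eval_mul, he k hk'.1 hk'.2] at h
    simp only [if_true, mul_one] at h
    rw [← h]
    refine intervalIntegral.integral_nonneg (by norm_num) fun x _ => ?_
    rw [eval_mul]
    exact mul_self_nonneg _
  · intro j hj hjk
    rw [Finset.mem_Icc] at hj
    simp [he j hj.1 hj.2, hjk]

lemma gauss_weight_le_two (hr : 1 ≤ r) (hG : IsGaussPoints r G) (hA : IsGaussWeights r G A)
    {k : ℕ} (hk : k ∈ Finset.Icc 1 r) : A k ≤ 2 := by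
  have h := gauss_exact hG hA 1 (by
    rw [degree_one]
    exact_mod_cast (by omega : 0 < 2 * r))
  norm_num at h
  rw [h]
  exact Finset.single_le_sum (f := A) (fun j hj => gauss_weight_nonneg hr hG hA hj) hk

/-! ### The reference cell -/

/-- Discrete primitive of `p'` on the reference interval: `p(-1)` plus the first `l` terms of the
Gauss rule applied to `p'`. -/
noncomputable def gaussPrimitive (G A : ℕ → ℝ) (p : ℝ[X]) (l : ℕ) : ℝ :=
  p.eval (-1) + ∑ k ∈ Finset.Icc 1 l, A k * (derivative p).eval (G k)

/-- The Gauss points augmented by `-1` (index `0`) and `1` (index `r + 1`). -/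
noncomputable def refNode (r : ℕ) (G : ℕ → ℝ) (l : ℕ) : ℝ :=
  if l = 0 then -1 else if l = r + 1 then 1 else G l

lemma gaussPrimitive_zero (p : ℝ[X]) : gaussPrimitive G A p 0 = p.eval (-1) := by
  simp [gaussPrimitive]

lemma gaussPrimitive_last (hr : 1 ≤ r) (hG : IsGaussPoints r G) (hA : IsGaussWeights r G A)
    (p : ℝ[X]) (hp : p.natDegree ≤ r) : gaussPrimitive G A p r = p.eval 1 := by
  rw [gaussPrimitive, ← gauss_exact hG hA, integral_eval_derivative]
  · ring
  · refine lt_of_le_of_lt (degree_le_of_natDegree_le (natDegree_derivative_le p)) ?_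
    exact_mod_cast (by omega : p.natDegree - 1 < 2 * r)

lemma sum_mul_sub_eq (V F : ℕ → ℝ) (n : ℕ) :
    ∑ l ∈ Finset.range (n + 1), V l * (F (l + 1) - F l) =
      V n * F (n + 1) - V 0 * F 0 - ∑ l ∈ Finset.Icc 1 n, (V l - V (l - 1)) * F l := by
  induction n with
  | zero => simp; ring
  | succ n ih =>
    rw [Finset.sum_range_succ, ih, Finset.sum_Icc_succ_top (by omega)]
    simp only [Nat.add_sub_cancel]
    ring

lemma reference_coercivity (hr : 1 ≤ r) (hG : IsGaussPoints r G) (hA : IsGaussWeights r G A)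
    (p : ℝ[X]) (hp : p.natDegree ≤ r) :
    ∫ x in (-1 : ℝ)..1, p.eval x ^ 2 ≤ ∑ l ∈ Finset.range (r + 1), gaussPrimitive G A p l *
      ∫ x in (refNode r G l)..(refNode r G (l + 1)), p.eval x := by
  obtain ⟨q, hq, hqd⟩ := p.exists_derivative_eq
  have hI : ∀ a b, ∫ x in a..b, p.eval x = q.eval b - q.eval a := fun a b => by
    rw [← hq, integral_eval_derivative]
  simp_rw [hI]
  rw [sum_mul_sub_eq (gaussPrimitive G A p) (fun l => q.eval (refNode r G l)),
    gaussPrimitive_last hr hG hA p hp, gaussPrimitive_zero]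
  have hsum : ∑ l ∈ Finset.Icc 1 r, (gaussPrimitive G A p l - gaussPrimitive G A p (l - 1)) *
      q.eval (refNode r G l) = ∑ l ∈ Finset.Icc 1 r, A l * (derivative p * q).eval (G l) := by
    refine Finset.sum_congr rfl fun l hl => ?_
    rw [Finset.mem_Icc] at hl
    obtain ⟨l, rfl⟩ : ∃ l', l = l' + 1 := ⟨l - 1, by omega⟩
    have : refNode r G (l + 1) = G (l + 1) := by
      rw [refNode, if_neg (by omega), if_neg (by omega)]
    rw [this, gaussPrimitive, gaussPrimitive, Finset.sum_Icc_succ_top (by omega),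
      Nat.add_sub_cancel, eval_mul]
    ring
  have hd : (derivative p).natDegree ≤ r - 1 := (natDegree_derivative_le p).trans (by omega)
  have hcoeff : 0 ≤ (derivative p * q).coeff (2 * r) := by
    rw [show 2 * r = (r - 1) + (r + 1) by omega,
      coeff_mul_add_eq_of_natDegree_le hd (by omega)]
    have h1 := coeff_derivative p (r - 1)
    have h2 := coeff_derivative q r
    rw [hq] at h2
    rw [show r - 1 + 1 = r by omega] at h1
    rw [h1, h2]
    have : 0 ≤ ((r - 1 : ℕ) : ℝ) + 1 := by positivity
    have h3 : 0 ≤ (r : ℝ) + 1 := by positivity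
    nlinarith [mul_nonneg (mul_nonneg h3 this) (sq_nonneg (q.coeff (r + 1)))]
  have hE := gauss_le_integral hG hA (derivative p * q)
    (natDegree_mul_le.trans (by omega)) hcoeff
  have hparts := integral_eval_derivative (p * q) (-1) 1
  rw [derivative_mul, hq] at hparts
  simp only [eval_add] at hparts
  rw [intervalIntegral.integral_add (intervalIntegrable_eval _ _ _)
    (intervalIntegrable_eval _ _ _)] at hparts
  have hsq : ∫ x in (-1 : ℝ)..1, p.eval x ^ 2 = ∫ x in (-1 : ℝ)..1, (p * p).eval x := by
    simp only [eval_mul, sq]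
  rw [hsum, hsq]
  simp only [eval_mul] at hparts hE ⊢
  simp only [refNode, if_true, Nat.add_eq_zero_iff, one_ne_zero, and_false, if_false]
  linarith

/-- On polynomials of degree at most `r`, the discrete primitive is controlled by the `L²` norm. -/
lemma exists_gaussPrimitive_sq_le (r : ℕ) (G A : ℕ → ℝ) :
    ∃ K : ℝ, 0 < K ∧ ∀ p : ℝ[X], p.natDegree ≤ r → ∀ l ∈ Finset.Icc 1 r,
      gaussPrimitive G A p l ^ 2 ≤ K * ∫ x in (-1 : ℝ)..1, p.eval x ^ 2 := by
  let T : (Fin (r + 1) → ℝ) →ₗ[ℝ] ℝ[X] := ∑ i : Fin (r + 1),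
    (monomial (i : ℕ)).comp (LinearMap.proj i)
  have hTe : ∀ e x, (T e).eval x = ∑ i : Fin (r + 1), e i * x ^ (i : ℕ) := fun e x => by
    simp [T, eval_finsetSum]
  have hT : ∀ p : ℝ[X], p.natDegree ≤ r → T (fun i => p.coeff i) = p := fun p hp => by
    conv_rhs => rw [p.as_sum_range' (r + 1) (by omega)]
    simp [T, Finset.sum_range]
  have hTinj : ∀ e, T e = 0 → e = 0 := fun e he => by
    funext i
    have := congrArg (fun p : ℝ[X] => p.coeff i) he
    simpa [T, finsetSum_coeff, coeff_monomial, Fin.val_inj] using this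
  let N : (Fin (r + 1) → ℝ) → ℝ := fun e => ∫ x in (-1 : ℝ)..1, (T e).eval x ^ 2
  have hNc : Continuous N := by
    refine intervalIntegral.continuous_parametric_intervalIntegral_of_continuous' ?_ _ _
    simp only [Function.uncurry_def, hTe]
    fun_prop
  have hNpos : ∀ e, e ≠ 0 → 0 < N e := fun e he => by
    have hne : T e ≠ 0 := fun h => he (hTinj e h)
    refine intervalIntegral.integral_pos (by norm_num) (by fun_prop)
      (fun x _ => sq_nonneg _) ?_
    by_contra! hcon
    refine hne (eq_zero_of_infinite_isRoot _ ((Set.Icc_infinite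
      (by norm_num : (-1 : ℝ) < 1)).mono fun x hx => ?_))
    exact pow_eq_zero_iff two_ne_zero |>.mp (le_antisymm (hcon x hx) (sq_nonneg _))
  let V : ℕ → (Fin (r + 1) → ℝ) → ℝ := fun l e => gaussPrimitive G A (T e) l
  have hTde : ∀ e x, (derivative (T e)).eval x =
      ∑ i : Fin (r + 1), e i * i * x ^ ((i : ℕ) - 1) := fun e x => by
    simp [T, eval_finsetSum, derivative_monomial]
  have hVc : ∀ l, Continuous (V l) := fun l => by
    simp only [V, gaussPrimitive, hTe, hTde]
    fun_prop
  have hVs : ∀ l (s : ℝ) e, V l (s • e) = s * V l e := fun l s e => by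
    simp only [V, gaussPrimitive, map_smul, eval_smul, smul_eq_mul, mul_add,
      Finset.mul_sum]
    congr 1
    exact Finset.sum_congr rfl fun k _ => by ring
  have hNs : ∀ (s : ℝ) e, N (s • e) = s ^ 2 * N e := fun s e => by
    simp only [N, map_smul, eval_smul, smul_eq_mul, mul_pow]
    rw [intervalIntegral.integral_const_mul]
  let R : (Fin (r + 1) → ℝ) → ℝ := fun e => (∑ l ∈ Finset.Icc 1 r, V l e ^ 2) / N e
  have hRc : ContinuousOn R (Metric.sphere 0 1) := by
    refine ContinuousOn.div (by fun_prop) hNc.continuousOn fun e he => (hNpos e ?_).ne'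
    rintro rfl
    simp at he
  obtain ⟨K, hK⟩ := (isCompact_sphere (0 : Fin (r + 1) → ℝ) 1).bddAbove_image hRc
  refine ⟨max K 1, by positivity, fun p hp l hl => ?_⟩
  set e : Fin (r + 1) → ℝ := fun i => p.coeff i with he
  have hTp : T e = p := hT p hp
  rw [← hTp]
  change V l e ^ 2 ≤ max K 1 * N e
  by_cases h0 : e = 0
  · have h1 := hVs l 0 e
    have h2 := hNs 0 e
    rw [h0] at h1 h2 ⊢
    simp only [smul_zero, zero_mul] at h1
    simp only [smul_zero] at h2
    rw [h1, h2]
    simp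
  · have hne : ‖e‖ ≠ 0 := norm_ne_zero_iff.mpr h0
    set e' := ‖e‖⁻¹ • e with he'
    have hmem : e' ∈ Metric.sphere (0 : Fin (r + 1) → ℝ) 1 := by
      simp [he', norm_smul, hne]
    have hee : e = ‖e‖ • e' := by
      rw [he', smul_smul, mul_inv_cancel₀ hne, one_smul]
    have hN' : 0 < N e' := hNpos e' fun h => by
      rw [h] at hmem
      simp at hmem
    have h1 : R e' ≤ max K 1 :=
      (hK (Set.mem_image_of_mem R hmem)).trans (le_max_left _ _)
    have h2 : V l e' ^ 2 ≤ max K 1 * N e' := by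
      refine le_trans ?_ ((div_le_iff₀ hN').mp h1)
      exact Finset.single_le_sum (f := fun l => V l e' ^ 2) (fun _ _ => sq_nonneg _) hl
    rw [hee, hVs, hNs, mul_pow]
    have := mul_le_mul_of_nonneg_left h2 (sq_nonneg ‖e‖)
    linarith

end Gauss

/-! ### One grid line -/

/-- Pull-back of `p` from `[a, b]` to the reference interval. -/
noncomputable def refPoly (a b : ℝ) (p : ℝ[X]) : ℝ[X] :=
  p.comp (C ((a + b) / 2) + C ((b - a) / 2) * X)

lemma refPoly_eval (a b : ℝ) (p : ℝ[X]) (s : ℝ) :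
    (refPoly a b p).eval s = p.eval ((a + b) / 2 + (b - a) / 2 * s) := by
  simp [refPoly]

lemma refPoly_derivative_eval (a b : ℝ) (p : ℝ[X]) (s : ℝ) :
    (derivative (refPoly a b p)).eval s =
      (b - a) / 2 * (derivative p).eval ((a + b) / 2 + (b - a) / 2 * s) := by
  simp [refPoly, derivative_comp]

lemma refPoly_natDegree_le (a b : ℝ) (p : ℝ[X]) : (refPoly a b p).natDegree ≤ p.natDegree := by
  refine natDegree_comp_le.trans ?_
  refine (Nat.mul_le_mul_left _ ?_).trans (mul_one _).le
  refine (natDegree_add_le _ _).trans (max_le (by simp) ?_)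
  exact (natDegree_C_mul_le _ _).trans natDegree_X_le

lemma integral_refPoly (a b : ℝ) (p : ℝ[X]) (s t : ℝ) :
    (b - a) / 2 * ∫ x in s..t, (refPoly a b p).eval x =
      ∫ x in ((a + b) / 2 + (b - a) / 2 * s)..((a + b) / 2 + (b - a) / 2 * t), p.eval x := by
  simp_rw [refPoly_eval]
  exact intervalIntegral.mul_integral_comp_add_mul (f := fun x => p.eval x) _ _

lemma integral_refPoly_sq (a b : ℝ) (p : ℝ[X]) :
    (b - a) / 2 * ∫ x in (-1 : ℝ)..1, (refPoly a b p).eval x ^ 2 = ∫ x in a..b, p.eval x ^ 2 := by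
  simp_rw [refPoly_eval]
  have h := intervalIntegral.mul_integral_comp_add_mul (a := -1) (b := 1)
    (f := fun x => p.eval x ^ 2) ((b - a) / 2) ((a + b) / 2)
  rw [h]
  congr 1 <;> ring

lemma integral_mul_eq_of_const_on_cell {a b : ℝ} (hab : a < b) (p : ℝ[X]) {β D : ℝ → ℝ} {κ : ℝ}
    (hβ : ∀ t ∈ Set.Ioo a b, β t = κ) (hD : ∀ t, D t = p.eval t) {s t : ℝ} (hs : -1 ≤ s)
    (hst : s ≤ t) (ht : t ≤ 1) :
    ∫ x in ((a + b) / 2 + (b - a) / 2 * s)..((a + b) / 2 + (b - a) / 2 * t), β x * D x =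
      κ * ((b - a) / 2 * ∫ x in s..t, (refPoly a b p).eval x) := by
  rw [integral_refPoly, ← intervalIntegral.integral_const_mul]
  have hle : (a + b) / 2 + (b - a) / 2 * s ≤ (a + b) / 2 + (b - a) / 2 * t := by nlinarith
  rw [intervalIntegral.integral_of_le hle, intervalIntegral.integral_of_le hle,
    integral_Ioc_eq_integral_Ioo, integral_Ioc_eq_integral_Ioo]
  refine setIntegral_congr_fun measurableSet_Ioo fun x hx => ?_
  rw [hβ x ⟨?_, ?_⟩, hD]
  · nlinarith [hx.1]
  · nlinarith [hx.2]

/-- The Gauss points of the grid `y 0 < … < y n`, with the conventions of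
`RectPartition.gx` and `RectPartition.gy`. -/
noncomputable def gridNode (r : ℕ) (G : ℕ → ℝ) (n : ℕ) (y : ℕ → ℝ) (j l : ℕ) : ℝ :=
  if l = r + 1 then
    (if j = n then y n else (y (j + 1) + y j + (y (j + 1) - y j) * G 1) / 2)
  else (y j + y (j - 1) + (y j - y (j - 1)) * G l) / 2

/-- The integral of a cellwise flux `β * D` between consecutive Gauss points of a grid, split at
the grid point `y j`. -/
noncomputable def lineIntegral (r : ℕ) (G : ℕ → ℝ) (n : ℕ) (y : ℕ → ℝ) (β : ℝ → ℝ)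
    (D : ℕ → ℝ → ℝ) (j l : ℕ) : ℝ :=
  (∫ t in (gridNode r G n y j l)..(min (gridNode r G n y j (l + 1)) (y j)), β t * D j t) +
    ∫ t in (y j)..(max (gridNode r G n y j (l + 1)) (y j)), β t * D (j + 1) t

/-- Cumulative sum of a doubly indexed family in lexicographic order. -/
def cumSum (r : ℕ) (f : ℕ → ℕ → ℝ) (j l : ℕ) : ℝ :=
  (∑ i ∈ Finset.Icc 1 (j - 1), ∑ p ∈ Finset.Icc 1 r, f i p) + ∑ p ∈ Finset.Icc 1 l, f j p

/-- A continuous piecewise polynomial of degree at most `r` on the grid `y 0 < … < y n` that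
vanishes at both ends. -/
structure IsLineSpline (r n : ℕ) (y : ℕ → ℝ) (p : ℕ → ℝ[X]) : Prop where
  pos : 0 < n
  lt : ∀ j < n, y j < y (j + 1)
  natDegree_le : ∀ j ∈ Finset.Icc 1 n, (p j).natDegree ≤ r
  match_eval : ∀ j, 1 ≤ j → j < n → (p j).eval (y j) = (p (j + 1)).eval (y j)
  left : (p 1).eval (y 0) = 0
  right : (p n).eval (y n) = 0

section Line

variable {r n : ℕ} {G A y : ℕ → ℝ} {p : ℕ → ℝ[X]}

/-- Quadrature weight times derivative at the Gauss points of a grid. -/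
noncomputable def weightedDerivative (r : ℕ) (G A : ℕ → ℝ) (n : ℕ) (y : ℕ → ℝ) (p : ℕ → ℝ[X])
    (j l : ℕ) : ℝ :=
  (y j - y (j - 1)) * A l / 2 * (derivative (p j)).eval (gridNode r G n y j l)

/-- Pull-back of the `j`-th piece of a spline to the reference interval. -/
noncomputable def refPiece (y : ℕ → ℝ) (p : ℕ → ℝ[X]) (j : ℕ) : ℝ[X] :=
  refPoly (y (j - 1)) (y j) (p j)

lemma gridNode_of_le {j l : ℕ} (hl : l ≤ r) :
    gridNode r G n y j l = (y (j - 1) + y j) / 2 + (y j - y (j - 1)) / 2 * G l := by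
  rw [gridNode, if_neg (by omega)]
  ring

lemma refPiece_eval_neg_one (j : ℕ) : (refPiece y p j).eval (-1) = (p j).eval (y (j - 1)) := by
  rw [refPiece, refPoly_eval]
  congr 1
  ring

lemma refPiece_eval_one (j : ℕ) : (refPiece y p j).eval 1 = (p j).eval (y j) := by
  rw [refPiece, refPoly_eval]
  congr 1
  ring

lemma IsLineSpline.refPiece_natDegree_le (hp : IsLineSpline r n y p) {j : ℕ}
    (hj : j ∈ Finset.Icc 1 n) : (refPiece y p j).natDegree ≤ r :=
  (refPoly_natDegree_le _ _ _).trans (hp.natDegree_le j hj)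

lemma IsLineSpline.lt_of_mem (hp : IsLineSpline r n y p) {j : ℕ}
    (hj : j ∈ Finset.Icc 1 n) : y (j - 1) < y j := by
  rw [Finset.mem_Icc] at hj
  have := hp.lt (j - 1) (by omega)
  rwa [show j - 1 + 1 = j by omega] at this

lemma sum_weightedDerivative {j l : ℕ} (hl : l ≤ r) :
    ∑ l' ∈ Finset.Icc 1 l, weightedDerivative r G A n y p j l' =
      gaussPrimitive G A (refPiece y p j) l - (p j).eval (y (j - 1)) := by
  rw [gaussPrimitive, refPiece_eval_neg_one, add_sub_cancel_left]
  refine Finset.sum_congr rfl fun k hk => ?_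
  rw [Finset.mem_Icc] at hk
  rw [weightedDerivative, refPiece, refPoly_derivative_eval, gridNode_of_le (by omega)]
  ring

lemma IsLineSpline.cumSum_eq (hr : 1 ≤ r) (hG : IsGaussPoints r G) (hA : IsGaussWeights r G A)
    (hp : IsLineSpline r n y p) {j l : ℕ} (hj : j ∈ Finset.Icc 1 n) (hl : l ≤ r) :
    cumSum r (weightedDerivative r G A n y p) j l = gaussPrimitive G A (refPiece y p j) l := by
  have key : ∀ j < n, ∑ j' ∈ Finset.Icc 1 j, ∑ l' ∈ Finset.Icc 1 r,
      weightedDerivative r G A n y p j' l' = (p (j + 1)).eval (y j) := by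
    intro j
    induction j with
    | zero => intro _; simp [hp.left]
    | succ j ih =>
      intro hj
      have hmem : j + 1 ∈ Finset.Icc 1 n := Finset.mem_Icc.mpr ⟨by omega, by omega⟩
      rw [Finset.sum_Icc_succ_top (by omega), ih (by omega), sum_weightedDerivative le_rfl,
        gaussPrimitive_last hr hG hA _ (hp.refPiece_natDegree_le hmem), refPiece_eval_one,
        ← hp.match_eval (j + 1) (by omega) hj]
      simp
  rw [Finset.mem_Icc] at hj
  obtain ⟨j, rfl⟩ : ∃ j', j = j' + 1 := ⟨j - 1, by omega⟩
  rw [cumSum, sum_weightedDerivative hl, Nat.add_sub_cancel, key j (by omega)]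
  ring

lemma IsLineSpline.cumSum_last (hr : 1 ≤ r) (hG : IsGaussPoints r G) (hA : IsGaussWeights r G A)
    (hp : IsLineSpline r n y p) : cumSum r (weightedDerivative r G A n y p) n r = 0 := by
  have hmem : n ∈ Finset.Icc 1 n := Finset.mem_Icc.mpr ⟨hp.pos, le_rfl⟩
  rw [hp.cumSum_eq hr hG hA hmem le_rfl,
    gaussPrimitive_last hr hG hA _ (hp.refPiece_natDegree_le hmem), refPiece_eval_one, hp.right]

lemma refNode_of_mem {l : ℕ} (h1 : 1 ≤ l) (h2 : l ≤ r) : refNode r G l = G l := by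
  rw [refNode, if_neg (by omega), if_neg (by omega)]

lemma refNode_zero : refNode r G 0 = -1 := by simp [refNode]

lemma refNode_last : refNode r G (r + 1) = 1 := by simp [refNode]

/-- The contribution of the `j`-th cell to the flux between consecutive reference nodes. -/
noncomputable def cellFlux (r : ℕ) (G : ℕ → ℝ) (y : ℕ → ℝ) (p : ℕ → ℝ[X]) (κ : ℕ → ℝ)
    (j l : ℕ) : ℝ :=
  κ j * ((y j - y (j - 1)) / 2 *
    ∫ x in (refNode r G l)..(refNode r G (l + 1)), (refPiece y p j).eval x)

lemma IsLineSpline.lineIntegral_of_lt (hG : IsGaussPoints r G)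
    (hp : IsLineSpline r n y p) {β : ℝ → ℝ} {κ : ℕ → ℝ} {D : ℕ → ℝ → ℝ}
    (hβ : ∀ j ∈ Finset.Icc 1 n, ∀ t ∈ Set.Ioo (y (j - 1)) (y j), β t = κ j)
    (hD : ∀ j ∈ Finset.Icc 1 n, ∀ t, D j t = (p j).eval t)
    {j l : ℕ} (hj : j ∈ Finset.Icc 1 n) (hl : 1 ≤ l) (hlr : l < r) :
    lineIntegral r G n y β D j l = cellFlux r G y p κ j l := by
  have hlt := hp.lt_of_mem hj
  have hl1 := (hG.2 l hl hlr.le).1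
  have hl2 := (hG.2 (l + 1) (by omega) hlr).1
  have hle : gridNode r G n y j (l + 1) ≤ y j := by
    rw [gridNode_of_le (by omega)]
    nlinarith [hl2.2]
  rw [lineIntegral, min_eq_left hle, max_eq_right hle, intervalIntegral.integral_same, add_zero,
    gridNode_of_le (by omega), gridNode_of_le (by omega),
    integral_mul_eq_of_const_on_cell hlt (p j) (hβ j hj) (hD j hj) hl1.1.le
      (hG.1 l hl hlr).le hl2.2.le, cellFlux, refNode_of_mem hl (by omega),
    refNode_of_mem (by omega) (by omega), refPiece]

lemma IsLineSpline.lineIntegral_last (hr : 1 ≤ r) (hG : IsGaussPoints r G)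
    (hp : IsLineSpline r n y p) {β : ℝ → ℝ} {κ : ℕ → ℝ} {D : ℕ → ℝ → ℝ}
    (hβ : ∀ j ∈ Finset.Icc 1 n, ∀ t ∈ Set.Ioo (y (j - 1)) (y j), β t = κ j)
    (hD : ∀ j ∈ Finset.Icc 1 n, ∀ t, D j t = (p j).eval t)
    {j : ℕ} (hj : 1 ≤ j) (hjn : j < n) :
    lineIntegral r G n y β D j r = cellFlux r G y p κ j r + cellFlux r G y p κ (j + 1) 0 := by
  have hm : j ∈ Finset.Icc 1 n := Finset.mem_Icc.mpr ⟨hj, hjn.le⟩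
  have hm' : j + 1 ∈ Finset.Icc 1 n := Finset.mem_Icc.mpr ⟨by omega, hjn⟩
  have hlt := hp.lt_of_mem hm
  have hlt' := hp.lt_of_mem hm'
  have hl1 := (hG.2 r hr le_rfl).1
  have hl2 := (hG.2 1 le_rfl hr).1
  have hnode : gridNode r G n y j (r + 1) =
      (y (j + 1 - 1) + y (j + 1)) / 2 + (y (j + 1) - y (j + 1 - 1)) / 2 * G 1 := by
    rw [gridNode, if_pos rfl, if_neg (by omega), Nat.add_sub_cancel]
    ring
  have hle : y j ≤ gridNode r G n y j (r + 1) := by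
    rw [hnode]
    simp only [Nat.add_sub_cancel] at hlt' ⊢
    nlinarith [hl2.1]
  have h1 := integral_mul_eq_of_const_on_cell hlt (p j) (hβ j hm) (hD j hm) hl1.1.le
    hl1.2.le le_rfl
  have h2 := integral_mul_eq_of_const_on_cell hlt' (p (j + 1)) (hβ _ hm') (hD _ hm') le_rfl
    hl2.1.le hl2.2.le
  rw [← hnode] at h2
  rw [show (y (j - 1) + y j) / 2 + (y j - y (j - 1)) / 2 * 1 = y j by ring] at h1
  rw [show (y (j + 1 - 1) + y (j + 1)) / 2 + (y (j + 1) - y (j + 1 - 1)) / 2 * -1 = y j by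
    rw [Nat.add_sub_cancel]
    ring] at h2
  rw [lineIntegral, min_eq_right hle, max_eq_left hle, gridNode_of_le le_rfl, h1, h2,
    cellFlux, cellFlux, refNode_of_mem hr le_rfl, refNode_last, refNode_zero,
    refNode_of_mem (l := 0 + 1) le_rfl hr, refPiece, refPiece]

lemma sum_Icc_sub_pred (E : ℕ → ℝ) (n : ℕ) :
    ∑ j ∈ Finset.Icc 1 n, (E j - E (j - 1)) = E n - E 0 := by
  induction n with
  | zero => simp
  | succ n ih =>
    rw [Finset.sum_Icc_succ_top (by omega), ih, Nat.add_sub_cancel]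
    ring

lemma sum_range_succ_eq_zero_add_Icc (f : ℕ → ℝ) (n : ℕ) :
    ∑ l ∈ Finset.range (n + 1), f l = f 0 + ∑ l ∈ Finset.Icc 1 n, f l := by
  induction n with
  | zero => simp
  | succ n ih =>
    rw [Finset.sum_range_succ, ih, Finset.sum_Icc_succ_top (by omega)]
    ring

lemma IsLineSpline.sum_mul_lineIntegral (hr : 1 ≤ r) (hG : IsGaussPoints r G)
    (hA : IsGaussWeights r G A) (hp : IsLineSpline r n y p) {β : ℝ → ℝ} {κ : ℕ → ℝ}
    {D : ℕ → ℝ → ℝ}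
    (hβ : ∀ j ∈ Finset.Icc 1 n, ∀ t ∈ Set.Ioo (y (j - 1)) (y j), β t = κ j)
    (hD : ∀ j ∈ Finset.Icc 1 n, ∀ t, D j t = (p j).eval t) :
    ∑ j ∈ Finset.Icc 1 n, ∑ l ∈ Finset.Icc 1 r,
        gaussPrimitive G A (refPiece y p j) l * lineIntegral r G n y β D j l =
      ∑ j ∈ Finset.Icc 1 n, ∑ l ∈ Finset.range (r + 1),
        gaussPrimitive G A (refPiece y p j) l * cellFlux r G y p κ j l := by
  let E : ℕ → ℝ := fun j =>
    if j = n then 0 else (p (j + 1)).eval (y j) * cellFlux r G y p κ (j + 1) 0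
  have hcell : ∀ j ∈ Finset.Icc 1 n,
      ∑ l ∈ Finset.Icc 1 r,
        gaussPrimitive G A (refPiece y p j) l * lineIntegral r G n y β D j l =
      ∑ l ∈ Finset.range (r + 1),
        gaussPrimitive G A (refPiece y p j) l * cellFlux r G y p κ j l + (E j - E (j - 1)) := by
    intro j hj
    have hj' := Finset.mem_Icc.mp hj
    have hlast := gaussPrimitive_last hr hG hA _ (hp.refPiece_natDegree_le hj)
    rw [refPiece_eval_one] at hlast
    have hpred : E (j - 1) = gaussPrimitive G A (refPiece y p j) 0 * cellFlux r G y p κ j 0 := by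
      simp only [E]
      rw [if_neg (by omega), gaussPrimitive_zero, refPiece_eval_neg_one,
        show j - 1 + 1 = j by omega]
    obtain ⟨s, rfl⟩ : ∃ s, r = s + 1 := ⟨r - 1, by omega⟩
    have hinner : ∑ l ∈ Finset.Icc 1 s,
        gaussPrimitive G A (refPiece y p j) l * lineIntegral (s + 1) G n y β D j l =
        ∑ l ∈ Finset.Icc 1 s,
          gaussPrimitive G A (refPiece y p j) l * cellFlux (s + 1) G y p κ j l := by
      refine Finset.sum_congr rfl fun l hl => ?_
      rw [Finset.mem_Icc] at hl
      rw [hp.lineIntegral_of_lt hG hβ hD hj hl.1 (by omega)]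
    rw [sum_range_succ_eq_zero_add_Icc, Finset.sum_Icc_succ_top (by omega),
      Finset.sum_Icc_succ_top (by omega), hinner, hpred, hlast]
    by_cases hjn : j = n
    · have hE : E j = 0 := by simp [E, hjn]
      rw [hE, hjn, hp.right]
      ring
    · have hE : E j = (p j).eval (y j) * cellFlux (s + 1) G y p κ (j + 1) 0 := by
        simp only [E]
        rw [if_neg hjn, hp.match_eval j hj'.1 (by omega)]
      rw [hE, hp.lineIntegral_last hr hG hβ hD hj'.1 (by omega)]
      ring
  rw [Finset.sum_congr rfl hcell, Finset.sum_add_distrib, sum_Icc_sub_pred]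
  have h0 : E 0 = 0 := by
    have := hp.pos
    simp only [E]
    rw [if_neg (by omega)]
    simp [hp.left]
  have hn : E n = 0 := by simp [E]
  rw [h0, hn]
  ring

/-- Coercivity along one grid line. -/
lemma IsLineSpline.coercivity (hr : 1 ≤ r) (hG : IsGaussPoints r G)
    (hA : IsGaussWeights r G A) (hp : IsLineSpline r n y p) {β : ℝ → ℝ} {κ : ℕ → ℝ}
    {D : ℕ → ℝ → ℝ} {α₀ : ℝ} (hα₀ : 0 ≤ α₀)
    (hβ : ∀ j ∈ Finset.Icc 1 n, ∀ t ∈ Set.Ioo (y (j - 1)) (y j), β t = κ j)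
    (hκ : ∀ j ∈ Finset.Icc 1 n, α₀ ≤ κ j)
    (hD : ∀ j ∈ Finset.Icc 1 n, ∀ t, D j t = (p j).eval t) :
    α₀ * ∑ j ∈ Finset.Icc 1 n, ∫ t in (y (j - 1))..(y j), (p j).eval t ^ 2 ≤
      ∑ j ∈ Finset.Icc 1 n, ∑ l ∈ Finset.Icc 1 r,
        cumSum r (weightedDerivative r G A n y p) j l * lineIntegral r G n y β D j l := by
  have hW : ∀ j ∈ Finset.Icc 1 n, ∀ l ∈ Finset.Icc 1 r,
      cumSum r (weightedDerivative r G A n y p) j l * lineIntegral r G n y β D j l =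
      gaussPrimitive G A (refPiece y p j) l * lineIntegral r G n y β D j l := by
    intro j hj l hl
    rw [hp.cumSum_eq hr hG hA hj (Finset.mem_Icc.mp hl).2]
  rw [Finset.sum_congr rfl fun j hj => Finset.sum_congr rfl (hW j hj),
    hp.sum_mul_lineIntegral hr hG hA hβ hD, Finset.mul_sum]
  refine Finset.sum_le_sum fun j hj => ?_
  have hlt := hp.lt_of_mem hj
  have href := reference_coercivity hr hG hA _ (hp.refPiece_natDegree_le hj)
  have hcell : ∑ l ∈ Finset.range (r + 1),
      gaussPrimitive G A (refPiece y p j) l * cellFlux r G y p κ j l =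
      κ j * ((y j - y (j - 1)) / 2 * ∑ l ∈ Finset.range (r + 1),
        gaussPrimitive G A (refPiece y p j) l *
          ∫ x in (refNode r G l)..(refNode r G (l + 1)), (refPiece y p j).eval x) := by
    simp only [Finset.mul_sum, cellFlux]
    exact Finset.sum_congr rfl fun l _ => by ring
  have hnn : 0 ≤ ∫ t in (y (j - 1))..(y j), (p j).eval t ^ 2 :=
    intervalIntegral.integral_nonneg hlt.le fun x _ => sq_nonneg _
  rw [hcell]
  refine (mul_le_mul_of_nonneg_right (hκ j hj) hnn).trans ?_
  refine mul_le_mul_of_nonneg_left ?_ (hα₀.trans (hκ j hj))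
  rw [← integral_refPoly_sq]
  exact mul_le_mul_of_nonneg_left href (by linarith)

/-- Boundedness of the discrete primitive along one grid line. -/
lemma IsLineSpline.mul_cumSum_sq_le (hr : 1 ≤ r) (hG : IsGaussPoints r G)
    (hA : IsGaussWeights r G A) (hp : IsLineSpline r n y p) {K : ℝ}
    (hK : ∀ q : ℝ[X], q.natDegree ≤ r → ∀ l ∈ Finset.Icc 1 r,
      gaussPrimitive G A q l ^ 2 ≤ K * ∫ x in (-1 : ℝ)..1, q.eval x ^ 2)
    {j l : ℕ} (hj : j ∈ Finset.Icc 1 n) (hl : l ∈ Finset.Icc 1 r) :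
    (y j - y (j - 1)) * cumSum r (weightedDerivative r G A n y p) j l ^ 2 ≤
      2 * K * ∫ t in (y (j - 1))..(y j), (p j).eval t ^ 2 := by
  have hlt := hp.lt_of_mem hj
  rw [hp.cumSum_eq hr hG hA hj (Finset.mem_Icc.mp hl).2, ← integral_refPoly_sq]
  have h := mul_le_mul_of_nonneg_left (hK _ (hp.refPiece_natDegree_le hj) l hl)
    (sub_nonneg.mpr hlt.le)
  refine h.trans (le_of_eq ?_)
  rw [refPiece]
  ring

end Line

/-! ### Bivariate polynomials by coefficients -/

/-- The bivariate polynomial of bidegree at most `r` with coefficients `e`. -/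
noncomputable def biEval (r : ℕ) (e : ℕ → ℕ → ℝ) (x y : ℝ) : ℝ :=
  ∑ a ∈ Finset.range (r + 1), ∑ b ∈ Finset.range (r + 1), e a b * x ^ a * y ^ b

/-- The `x`-derivative of `biEval r e` at fixed `x`, as a polynomial in `y`. -/
noncomputable def dxPoly (r : ℕ) (e : ℕ → ℕ → ℝ) (x : ℝ) : ℝ[X] :=
  ∑ a ∈ Finset.range (r + 1), ∑ b ∈ Finset.range (r + 1), monomial b (e a b * (a * x ^ (a - 1)))

lemma biEval_swap (r : ℕ) (e : ℕ → ℕ → ℝ) (x y : ℝ) :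
    biEval r (Function.swap e) y x = biEval r e x y := by
  rw [biEval, Finset.sum_comm, biEval]
  exact Finset.sum_congr rfl fun a _ => Finset.sum_congr rfl fun b _ => by
    simp only [Function.swap]
    ring

lemma dxPoly_eval (r : ℕ) (e : ℕ → ℕ → ℝ) (x y : ℝ) :
    (dxPoly r e x).eval y = ∑ a ∈ Finset.range (r + 1), ∑ b ∈ Finset.range (r + 1),
      e a b * (a * x ^ (a - 1)) * y ^ b := by
  simp [dxPoly, eval_finsetSum]

lemma dxPoly_natDegree_le (r : ℕ) (e : ℕ → ℕ → ℝ) (x : ℝ) : (dxPoly r e x).natDegree ≤ r := by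
  refine natDegree_sum_le_of_forall_le _ _ fun a _ =>
    natDegree_sum_le_of_forall_le _ _ fun b hb => (natDegree_monomial_le _).trans ?_
  have := Finset.mem_range.mp hb
  omega

lemma dxPoly_derivative_eval (r : ℕ) (e : ℕ → ℕ → ℝ) (x y : ℝ) :
    (derivative (dxPoly r e x)).eval y = ∑ a ∈ Finset.range (r + 1), ∑ b ∈ Finset.range (r + 1),
      e a b * (a * x ^ (a - 1)) * (b * y ^ (b - 1)) := by
  simp [dxPoly, eval_finsetSum, derivative_monomial, mul_assoc]

lemma dxPoly_derivative_swap (r : ℕ) (e : ℕ → ℕ → ℝ) (x y : ℝ) :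
    (derivative (dxPoly r (Function.swap e) y)).eval x = (derivative (dxPoly r e x)).eval y := by
  rw [dxPoly_derivative_eval, Finset.sum_comm, dxPoly_derivative_eval]
  exact Finset.sum_congr rfl fun a _ => Finset.sum_congr rfl fun b _ => by
    simp only [Function.swap]
    ring

lemma exists_eval_eq_dxPoly_eval (r : ℕ) (e : ℕ → ℕ → ℝ) (y : ℝ) :
    ∃ q : ℝ[X], q.natDegree ≤ r - 1 ∧ ∀ x, (dxPoly r e x).eval y = q.eval x := by
  refine ⟨derivative (∑ a ∈ Finset.range (r + 1), ∑ b ∈ Finset.range (r + 1),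
    monomial a (e a b * y ^ b)), ?_, fun x => ?_⟩
  · refine (natDegree_derivative_le _).trans (Nat.sub_le_sub_right ?_ 1)
    refine natDegree_sum_le_of_forall_le _ _ fun a ha =>
      natDegree_sum_le_of_forall_le _ _ fun b _ => (natDegree_monomial_le _).trans ?_
    have := Finset.mem_range.mp ha
    omega
  · rw [dxPoly_eval]
    simp only [derivative_sum, derivative_monomial, eval_finsetSum, eval_monomial]
    exact Finset.sum_congr rfl fun a _ => Finset.sum_congr rfl fun b _ => by ring

lemma continuous_dxPoly_eval (r : ℕ) (e : ℕ → ℕ → ℝ) :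
    Continuous fun z : ℝ × ℝ => (dxPoly r e z.1).eval z.2 := by
  simp only [dxPoly_eval]
  fun_prop

lemma hasDerivAt_biEval (r : ℕ) (e : ℕ → ℕ → ℝ) (x y : ℝ) :
    HasDerivAt (fun s => biEval r e s y) ((dxPoly r e x).eval y) x := by
  rw [dxPoly_eval]
  refine HasDerivAt.fun_sum fun a _ => HasDerivAt.fun_sum fun b _ => ?_
  exact ((hasDerivAt_pow a x).const_mul (e a b)).mul_const (y ^ b)

lemma fderiv_biEval (r : ℕ) (e : ℕ → ℕ → ℝ) (z : ℝ × ℝ) :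
    fderiv ℝ (fun z : ℝ × ℝ => biEval r e z.1 z.2) z (1, 0) = (dxPoly r e z.1).eval z.2 ∧
    fderiv ℝ (fun z : ℝ × ℝ => biEval r e z.1 z.2) z (0, 1) =
      (dxPoly r (Function.swap e) z.2).eval z.1 := by
  have hd : DifferentiableAt ℝ (fun z : ℝ × ℝ => biEval r e z.1 z.2) z := by
    unfold biEval
    fun_prop
  constructor
  · have hl : HasDerivAt (fun s : ℝ => (s, z.2)) ((1 : ℝ), (0 : ℝ)) z.1 :=
      (hasDerivAt_id z.1).prodMk (hasDerivAt_const _ _)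
    have h := HasFDerivAt.comp_hasDerivAt (f := fun s : ℝ => (s, z.2))
      z.1 hd.hasFDerivAt hl
    exact h.unique (hasDerivAt_biEval r e z.1 z.2)
  · have hl : HasDerivAt (fun s : ℝ => (z.1, s)) ((0 : ℝ), (1 : ℝ)) z.2 :=
      (hasDerivAt_const _ _).prodMk (hasDerivAt_id z.2)
    have h := HasFDerivAt.comp_hasDerivAt (f := fun s : ℝ => (z.1, s))
      z.2 hd.hasFDerivAt hl
    refine h.unique ?_
    have := hasDerivAt_biEval r (Function.swap e) z.2 z.1
    simp only [biEval_swap] at this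
    exact this

/-! ### One coordinate direction -/

section Direction

variable {r m n : ℕ} {G A x y : ℕ → ℝ} {e : ℕ → ℕ → ℕ → ℕ → ℝ}

lemma integral_cell_dxPoly_sq (hr : 1 ≤ r) (hG : IsGaussPoints r G) (hA : IsGaussWeights r G A)
    (e : ℕ → ℕ → ℝ) {a b c d : ℝ} (hab : a ≤ b) (hcd : c ≤ d) :
    ∫ z in Set.Icc a b ×ˢ Set.Icc c d, (dxPoly r e z.1).eval z.2 ^ 2 =
      ∑ k ∈ Finset.Icc 1 r, (b - a) * A k / 2 *
        ∫ t in c..d, (dxPoly r e ((a + b) / 2 + (b - a) / 2 * G k)).eval t ^ 2 := by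
  have hcont := continuous_dxPoly_eval r e
  rw [Measure.volume_eq_prod, ← setIntegral_prod_swap, setIntegral_prod]
  · have hinner : ∀ t, ∫ s in Set.Icc a b, (dxPoly r e s).eval t ^ 2 =
        ∑ k ∈ Finset.Icc 1 r, (b - a) * A k / 2 *
          (dxPoly r e ((a + b) / 2 + (b - a) / 2 * G k)).eval t ^ 2 := by
      intro t
      obtain ⟨q, hqd, hq⟩ := exists_eval_eq_dxPoly_eval r e t
      have hdeg : (refPoly a b q * refPoly a b q).degree < (2 * r : ℕ) := by
        refine lt_of_le_of_lt (degree_le_of_natDegree_le natDegree_mul_le) ?_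
        have := refPoly_natDegree_le a b q
        exact_mod_cast (by omega : (refPoly a b q).natDegree + (refPoly a b q).natDegree < 2 * r)
      have hex := gauss_exact hG hA _ hdeg
      simp only [hq]
      rw [integral_Icc_eq_integral_Ioc, ← intervalIntegral.integral_of_le hab,
        ← integral_refPoly_sq]
      simp only [← sq, eval_pow] at hex
      rw [hex, Finset.mul_sum]
      refine Finset.sum_congr rfl fun k _ => ?_
      rw [refPoly_eval]
      ring
    simp only [Prod.swap, hinner]
    rw [integral_Icc_eq_integral_Ioc, ← intervalIntegral.integral_of_le hcd,
      intervalIntegral.integral_finsetSum]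
    · exact Finset.sum_congr rfl fun k _ => intervalIntegral.integral_const_mul _ _
    · intro k _
      exact Continuous.intervalIntegrable (by fun_prop) _ _
  · refine ContinuousOn.integrableOn_compact (isCompact_Icc.prod isCompact_Icc) ?_
    exact ((hcont.comp continuous_swap).pow 2).continuousOn

/-- The jump across the grid line `x = g_{i,k}` of the test function attached to a spline. -/
noncomputable def lineJump (r : ℕ) (G A : ℕ → ℝ) (m : ℕ) (x : ℕ → ℝ) (n : ℕ) (y : ℕ → ℝ)
    (e : ℕ → ℕ → ℕ → ℕ → ℝ) (i k j l : ℕ) : ℝ :=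
  (x i - x (i - 1)) * A k / 2 * cumSum r (weightedDerivative r G A n y
    fun j' => dxPoly r (e i j') (gridNode r G m x i k)) j l

/-- The squared `L²` norm of the cellwise `x`-derivative of a spline. -/
noncomputable def dxEnergy (r m : ℕ) (x : ℕ → ℝ) (n : ℕ) (y : ℕ → ℝ)
    (e : ℕ → ℕ → ℕ → ℕ → ℝ) : ℝ :=
  ∑ i ∈ Finset.Icc 1 m, ∑ j ∈ Finset.Icc 1 n,
    ∫ z in Set.Icc (x (i - 1)) (x i) ×ˢ Set.Icc (y (j - 1)) (y j),
      (dxPoly r (e i j) z.1).eval z.2 ^ 2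

/-- Along every line `x = s` inside a column of cells, the `x`-derivative is a spline in `y`. -/
def IsDxSpline (r m : ℕ) (x : ℕ → ℝ) (n : ℕ) (y : ℕ → ℝ) (e : ℕ → ℕ → ℕ → ℕ → ℝ) : Prop :=
  (∀ i < m, x i < x (i + 1)) ∧ (∀ j < n, y j < y (j + 1)) ∧
  ∀ i ∈ Finset.Icc 1 m, ∀ s ∈ Set.Ioo (x (i - 1)) (x i),
    IsLineSpline r n y fun j => dxPoly r (e i j) s

lemma pred_lt_of_mem_Icc (hx : ∀ i < m, x i < x (i + 1)) {i : ℕ} (hi : i ∈ Finset.Icc 1 m) :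
    x (i - 1) < x i := by
  rw [Finset.mem_Icc] at hi
  have := hx (i - 1) (by omega)
  rwa [show i - 1 + 1 = i by omega] at this

lemma gridNode_mem_Ioo (hG : IsGaussPoints r G) (hx : ∀ i < m, x i < x (i + 1)) {i k : ℕ}
    (hi : i ∈ Finset.Icc 1 m) (hk : k ∈ Finset.Icc 1 r) :
    gridNode r G m x i k ∈ Set.Ioo (x (i - 1)) (x i) := by
  rw [Finset.mem_Icc] at hk
  have hlt := pred_lt_of_mem_Icc hx hi
  have hGk := (hG.2 k hk.1 hk.2).1
  rw [gridNode_of_le hk.2]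
  constructor <;> nlinarith [hGk.1, hGk.2]

lemma IsDxSpline.dxEnergy_eq (hr : 1 ≤ r) (hG : IsGaussPoints r G) (hA : IsGaussWeights r G A)
    (he : IsDxSpline r m x n y e) :
    dxEnergy r m x n y e = ∑ i ∈ Finset.Icc 1 m, ∑ k ∈ Finset.Icc 1 r,
      (x i - x (i - 1)) * A k / 2 * ∑ j ∈ Finset.Icc 1 n,
        ∫ t in (y (j - 1))..(y j), (dxPoly r (e i j) (gridNode r G m x i k)).eval t ^ 2 := by
  refine Finset.sum_congr rfl fun i hi => ?_
  simp only [Finset.mul_sum]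
  rw [Finset.sum_comm]
  refine Finset.sum_congr rfl fun j hj => ?_
  rw [integral_cell_dxPoly_sq hr hG hA _ (pred_lt_of_mem_Icc he.1 hi).le
    (pred_lt_of_mem_Icc he.2.1 hj).le]
  refine Finset.sum_congr rfl fun k hk => ?_
  rw [gridNode_of_le (Finset.mem_Icc.mp hk).2]

lemma IsDxSpline.lineJump_last (hr : 1 ≤ r) (hG : IsGaussPoints r G) (hA : IsGaussWeights r G A)
    (he : IsDxSpline r m x n y e) {i k : ℕ} (hi : i ∈ Finset.Icc 1 m) (hk : k ∈ Finset.Icc 1 r) :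
    lineJump r G A m x n y e i k n r = 0 := by
  rw [lineJump, (he.2.2 i hi _ (gridNode_mem_Ioo hG he.1 hi hk)).cumSum_last hr hG hA, mul_zero]

/-- Coercivity of one half of the bilinear form. -/
lemma IsDxSpline.coercivity (hr : 1 ≤ r) (hG : IsGaussPoints r G) (hA : IsGaussWeights r G A)
    (he : IsDxSpline r m x n y e) {f : ℝ → ℝ → ℝ} {κ : ℕ → ℕ → ℝ} {D : ℕ → ℕ → ℝ → ℝ → ℝ}
    {α₀ : ℝ} (hα₀ : 0 ≤ α₀)
    (hf : ∀ i ∈ Finset.Icc 1 m, ∀ j ∈ Finset.Icc 1 n, ∀ s ∈ Set.Ioo (x (i - 1)) (x i),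
      ∀ t ∈ Set.Ioo (y (j - 1)) (y j), f s t = κ i j)
    (hκ : ∀ i ∈ Finset.Icc 1 m, ∀ j ∈ Finset.Icc 1 n, α₀ ≤ κ i j)
    (hD : ∀ i ∈ Finset.Icc 1 m, ∀ j ∈ Finset.Icc 1 n, ∀ s t,
      D i j s t = (dxPoly r (e i j) s).eval t) :
    α₀ * dxEnergy r m x n y e ≤ ∑ i ∈ Finset.Icc 1 m, ∑ k ∈ Finset.Icc 1 r,
      ∑ j ∈ Finset.Icc 1 n, ∑ l ∈ Finset.Icc 1 r, lineJump r G A m x n y e i k j l *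
        lineIntegral r G n y (f (gridNode r G m x i k))
          (fun j' => D i j' (gridNode r G m x i k)) j l := by
  rw [he.dxEnergy_eq hr hG hA, Finset.mul_sum]
  refine Finset.sum_le_sum fun i hi => ?_
  rw [Finset.mul_sum]
  refine Finset.sum_le_sum fun k hk => ?_
  have hg := gridNode_mem_Ioo hG he.1 hi hk
  have h := (he.2.2 i hi _ hg).coercivity hr hG hA hα₀
    (fun j hj t ht => hf i hi j hj _ hg t ht) (fun j hj => hκ i hi j hj)
    (D := fun j' => D i j' (gridNode r G m x i k)) (fun j hj t => hD i hi j hj _ t)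
  have hB : 0 ≤ (x i - x (i - 1)) * A k / 2 := by
    have := mul_nonneg (sub_nonneg.mpr (pred_lt_of_mem_Icc he.1 hi).le)
      (gauss_weight_nonneg hr hG hA hk)
    linarith
  have h' := mul_le_mul_of_nonneg_left h hB
  rw [mul_left_comm]
  refine h'.trans (le_of_eq ?_)
  simp only [Finset.mul_sum, lineJump]
  exact Finset.sum_congr rfl fun j _ => Finset.sum_congr rfl fun l _ => by ring

/-- Boundedness of the jumps in terms of the energy. -/
lemma IsDxSpline.sum_lineJump_sq_le (hr : 1 ≤ r) (hG : IsGaussPoints r G)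
    (hA : IsGaussWeights r G A) (he : IsDxSpline r m x n y e) {K σ : ℝ} (hσ : 0 ≤ σ)
    (hK : ∀ q : ℝ[X], q.natDegree ≤ r → ∀ l ∈ Finset.Icc 1 r,
      gaussPrimitive G A q l ^ 2 ≤ K * ∫ x in (-1 : ℝ)..1, q.eval x ^ 2)
    (hxy : ∀ i ∈ Finset.Icc 1 m, ∀ j ∈ Finset.Icc 1 n,
      x i - x (i - 1) ≤ σ * (y j - y (j - 1))) :
    ∑ i ∈ Finset.Icc 1 m, ∑ k ∈ Finset.Icc 1 r, ∑ j ∈ Finset.Icc 1 n, ∑ l ∈ Finset.Icc 1 r,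
      lineJump r G A m x n y e i k j l ^ 2 ≤ r * (σ * (2 * K)) * dxEnergy r m x n y e := by
  rw [he.dxEnergy_eq hr hG hA, Finset.mul_sum]
  refine Finset.sum_le_sum fun i hi => ?_
  rw [Finset.mul_sum]
  refine Finset.sum_le_sum fun k hk => ?_
  rw [Finset.mul_sum, Finset.mul_sum]
  refine Finset.sum_le_sum fun j hj => ?_
  have hg := gridNode_mem_Ioo hG he.1 hi hk
  have hx := pred_lt_of_mem_Icc he.1 hi
  have hA0 := gauss_weight_nonneg hr hG hA hk
  have hA2 := gauss_weight_le_two hr hG hA hk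
  set B := (x i - x (i - 1)) * A k / 2 with hBdef
  have hB : 0 ≤ B := by nlinarith
  have hBy : B ≤ σ * (y j - y (j - 1)) := le_trans (by nlinarith) (hxy i hi j hj)
  have hterm : ∀ l ∈ Finset.Icc 1 r, lineJump r G A m x n y e i k j l ^ 2 ≤
      σ * (2 * K) * (B * ∫ t in (y (j - 1))..(y j),
        (dxPoly r (e i j) (gridNode r G m x i k)).eval t ^ 2) := by
    intro l hl
    have h := (he.2.2 i hi _ hg).mul_cumSum_sq_le hr hG hA hK hj hl
    rw [lineJump, ← hBdef]
    set W := cumSum r (weightedDerivative r G A n y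
      fun j' => dxPoly r (e i j') (gridNode r G m x i k)) j l
    calc (B * W) ^ 2 = B * (B * W ^ 2) := by ring
      _ ≤ B * (σ * (y j - y (j - 1)) * W ^ 2) :=
        mul_le_mul_of_nonneg_left (mul_le_mul_of_nonneg_right hBy (sq_nonneg _)) hB
      _ = B * (σ * ((y j - y (j - 1)) * W ^ 2)) := by ring
      _ ≤ B * (σ * _) := mul_le_mul_of_nonneg_left (mul_le_mul_of_nonneg_left h hσ) hB
      _ = _ := by ring
  refine (Finset.sum_le_sum hterm).trans (le_of_eq ?_)
  rw [Finset.sum_const, Nat.card_Icc, nsmul_eq_mul, Nat.add_sub_cancel]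
  ring

end Direction

/-! ### Splines from trial functions -/

section Grid

variable {r m n : ℕ} {x y : ℕ → ℝ} {e : ℕ → ℕ → ℕ → ℕ → ℝ} {u : ℝ → ℝ → ℝ}

lemma grid_le (hx : ∀ i < m, x i < x (i + 1)) {i j : ℕ} (hij : i ≤ j) (hj : j ≤ m) :
    x i ≤ x j := by
  induction j, hij using Nat.le_induction with
  | base => exact le_rfl
  | succ j _ ih => exact (ih (by omega)).trans (hx j (by omega)).le

lemma grid_cell_subset (hx : ∀ i < m, x i < x (i + 1)) {i : ℕ} (hi : i ∈ Finset.Icc 1 m) :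
    Set.Icc (x (i - 1)) (x i) ⊆ Set.Icc (x 0) (x m) := by
  rw [Finset.mem_Icc] at hi
  exact Set.Icc_subset_Icc (grid_le hx (Nat.zero_le _) (by omega)) (grid_le hx hi.2 le_rfl)

lemma exists_grid_cell (hm : 0 < m) {s : ℝ} (hs : s ∈ Set.Icc (x 0) (x m)) :
    ∃ i ∈ Finset.Icc 1 m, s ∈ Set.Icc (x (i - 1)) (x i) := by
  induction m, hm using Nat.le_induction with
  | base => exact ⟨1, by simp, by simpa using hs⟩
  | succ m hm ih =>
    rcases le_total s (x m) with h | h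
    · obtain ⟨i, hi, hsi⟩ := ih ⟨hs.1, h⟩
      rw [Finset.mem_Icc] at hi
      exact ⟨i, Finset.mem_Icc.mpr ⟨hi.1, by omega⟩, hsi⟩
    · exact ⟨m + 1, Finset.mem_Icc.mpr ⟨by omega, le_rfl⟩, by simpa using ⟨h, hs.2⟩⟩

lemma dxPoly_eval_eq_of_eqOn {e e' : ℕ → ℕ → ℝ} {a b s t : ℝ} (hs : s ∈ Set.Ioo a b)
    (h : ∀ s ∈ Set.Icc a b, biEval r e s t = biEval r e' s t) :
    (dxPoly r e s).eval t = (dxPoly r e' s).eval t := by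
  refine (hasDerivAt_biEval r e s t).unique ((hasDerivAt_biEval r e' s t).congr_of_eventuallyEq ?_)
  filter_upwards [Icc_mem_nhds hs.1 hs.2] with s' hs' using h s' hs'

lemma dxPoly_eval_eq_zero_of_eqOn {e : ℕ → ℕ → ℝ} {a b s t : ℝ} (hs : s ∈ Set.Ioo a b)
    (h : ∀ s ∈ Set.Icc a b, biEval r e s t = 0) : (dxPoly r e s).eval t = 0 := by
  refine (hasDerivAt_biEval r e s t).unique
    ((hasDerivAt_const s (0 : ℝ)).congr_of_eventuallyEq ?_)
  filter_upwards [Icc_mem_nhds hs.1 hs.2] with s' hs' using h s' hs'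

lemma isDxSpline_of_agree (hn : 0 < n) (hx : ∀ i < m, x i < x (i + 1))
    (hy : ∀ j < n, y j < y (j + 1))
    (hu : ∀ i ∈ Finset.Icc 1 m, ∀ j ∈ Finset.Icc 1 n, ∀ s ∈ Set.Icc (x (i - 1)) (x i),
      ∀ t ∈ Set.Icc (y (j - 1)) (y j), biEval r (e i j) s t = u s t)
    (h0 : ∀ s ∈ Set.Icc (x 0) (x m), u s (y 0) = 0)
    (h1 : ∀ s ∈ Set.Icc (x 0) (x m), u s (y n) = 0) : IsDxSpline r m x n y e := by
  refine ⟨hx, hy, fun i hi s hs => ⟨hn, hy, fun j _ => dxPoly_natDegree_le _ _ _, ?_, ?_, ?_⟩⟩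
  · intro j hj hjn
    have hm : j ∈ Finset.Icc 1 n := Finset.mem_Icc.mpr ⟨hj, hjn.le⟩
    have hm' : j + 1 ∈ Finset.Icc 1 n := Finset.mem_Icc.mpr ⟨by omega, hjn⟩
    refine dxPoly_eval_eq_of_eqOn hs fun s' hs' => ?_
    rw [hu i hi j hm s' hs' _ ⟨(pred_lt_of_mem_Icc hy hm).le, le_rfl⟩,
      hu i hi (j + 1) hm' s' hs' _ ⟨by simp, (hy j hjn).le⟩]
  · have hm : 1 ∈ Finset.Icc 1 n := Finset.mem_Icc.mpr ⟨le_rfl, hn⟩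
    refine dxPoly_eval_eq_zero_of_eqOn hs fun s' hs' => ?_
    rw [hu i hi 1 hm s' hs' _ ⟨by simp, (hy 0 hn).le⟩, h0 s' (grid_cell_subset hx hi hs')]
  · have hm : n ∈ Finset.Icc 1 n := Finset.mem_Icc.mpr ⟨hn, le_rfl⟩
    refine dxPoly_eval_eq_zero_of_eqOn hs fun s' hs' => ?_
    rw [hu i hi n hm s' hs' _ ⟨(pred_lt_of_mem_Icc hy hm).le, le_rfl⟩,
      h1 s' (grid_cell_subset hx hi hs')]

lemma dxEnergy_nonneg : 0 ≤ dxEnergy r m x n y e :=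
  Finset.sum_nonneg fun _ _ => Finset.sum_nonneg fun _ _ => integral_nonneg fun _ => sq_nonneg _

lemma integrableOn_dxPoly_sq (e : ℕ → ℕ → ℝ) (a b c d : ℝ) :
    IntegrableOn (fun z : ℝ × ℝ => (dxPoly r e z.1).eval z.2 ^ 2)
      (Set.Icc a b ×ˢ Set.Icc c d) :=
  ((continuous_dxPoly_eval r e).pow 2).continuousOn.integrableOn_compact
    (isCompact_Icc.prod isCompact_Icc)

lemma dxPoly_eval_eq_zero_of_integral {e : ℕ → ℕ → ℝ} {a b c d : ℝ} (hab : a < b) (hcd : c < d)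
    (h : ∫ z in Set.Icc a b ×ˢ Set.Icc c d, (dxPoly r e z.1).eval z.2 ^ 2 = 0) {s t : ℝ}
    (hs : s ∈ Set.Icc a b) (ht : t ∈ Set.Icc c d) : (dxPoly r e s).eval t = 0 := by
  rw [setIntegral_eq_zero_iff_of_nonneg_ae
    (Filter.Eventually.of_forall fun _ => sq_nonneg _) (integrableOn_dxPoly_sq e a b c d)] at h
  have hE := Measure.eqOn_of_ae_eq h ((continuous_dxPoly_eval r e).pow 2).continuousOn
    continuousOn_const (by
      rw [interior_prod_eq, closure_prod_eq, interior_Icc, interior_Icc, closure_Ioo hab.ne,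
        closure_Ioo hcd.ne])
  exact pow_eq_zero_iff two_ne_zero |>.mp (hE (Set.mk_mem_prod hs ht))

/-- A spline vanishing on the left edge is determined by its `x`-derivative. -/
lemma eq_zero_of_dxEnergy_eq_zero (hm : 0 < m) (hn : 0 < n) (hx : ∀ i < m, x i < x (i + 1))
    (hy : ∀ j < n, y j < y (j + 1))
    (hu : ∀ i ∈ Finset.Icc 1 m, ∀ j ∈ Finset.Icc 1 n, ∀ s ∈ Set.Icc (x (i - 1)) (x i),
      ∀ t ∈ Set.Icc (y (j - 1)) (y j), biEval r (e i j) s t = u s t)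
    (h0 : ∀ t ∈ Set.Icc (y 0) (y n), u (x 0) t = 0) (hE : dxEnergy r m x n y e = 0)
    {s t : ℝ} (hs : s ∈ Set.Icc (x 0) (x m)) (ht : t ∈ Set.Icc (y 0) (y n)) : u s t = 0 := by
  obtain ⟨j, hj, htj⟩ := exists_grid_cell hn ht
  have hnn : ∀ i j, 0 ≤ ∫ z in Set.Icc (x (i - 1)) (x i) ×ˢ Set.Icc (y (j - 1)) (y j),
      (dxPoly r (e i j) z.1).eval z.2 ^ 2 := fun i j => integral_nonneg fun _ => sq_nonneg _
  have hconst : ∀ i ∈ Finset.Icc 1 m, ∀ s ∈ Set.Icc (x (i - 1)) (x i),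
      u s t = u (x (i - 1)) t := by
    intro i hi s hs
    have hI : ∫ z in Set.Icc (x (i - 1)) (x i) ×ˢ Set.Icc (y (j - 1)) (y j),
        (dxPoly r (e i j) z.1).eval z.2 ^ 2 = 0 := by
      have h1 := (Finset.sum_eq_zero_iff_of_nonneg
        fun i _ => Finset.sum_nonneg fun j _ => hnn i j).mp hE i hi
      exact (Finset.sum_eq_zero_iff_of_nonneg fun j _ => hnn i j).mp h1 j hj
    have hlt := pred_lt_of_mem_Icc hx hi
    have hder : ∀ s ∈ Set.Ico (x (i - 1)) (x i),
        HasDerivWithinAt (fun s => biEval r (e i j) s t) 0 (Set.Ici s) s := by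
      intro s hs
      have := hasDerivAt_biEval r (e i j) s t
      rw [dxPoly_eval_eq_zero_of_integral hlt (pred_lt_of_mem_Icc hy hj) hI ⟨hs.1, hs.2.le⟩
        htj] at this
      exact this.hasDerivWithinAt
    have := constant_of_has_deriv_right_zero
      (fun s _ => (hasDerivAt_biEval r (e i j) s t).continuousAt.continuousWithinAt) hder s hs
    rwa [hu i hi j hj s hs t htj, hu i hi j hj _ ⟨le_rfl, hlt.le⟩ t htj] at this
  have hnodes : ∀ i ≤ m, u (x i) t = 0 := by
    intro i
    induction i with
    | zero => intro _; exact h0 t ht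
    | succ i ih =>
      intro hi
      have hmem : i + 1 ∈ Finset.Icc 1 m := Finset.mem_Icc.mpr ⟨by omega, hi⟩
      rw [hconst (i + 1) hmem _ ⟨(pred_lt_of_mem_Icc hx hmem).le, le_rfl⟩, Nat.add_sub_cancel]
      exact ih (by omega)
  obtain ⟨i, hi, hsi⟩ := exists_grid_cell hm hs
  rw [hconst i hi s hsi]
  rw [Finset.mem_Icc] at hi
  exact hnodes _ (by omega)

end Grid

/-! ### The test function attached to a spline -/

lemma cumSum_comm (r : ℕ) (a : ℕ → ℕ → ℕ → ℕ → ℝ) (i k j l : ℕ) :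
    cumSum r (fun i' k' => cumSum r (a i' k') j l) i k =
      cumSum r (fun j' l' => cumSum r (fun i' k' => a i' k' j' l') i k) j l := by
  have hswap : ∀ (s t : Finset ℕ) (s' : Finset ℕ) (f : ℕ → ℕ → ℕ → ℝ),
      ∑ i ∈ s, ∑ k ∈ t, ∑ j ∈ s', f i k j = ∑ j ∈ s', ∑ i ∈ s, ∑ k ∈ t, f i k j := by
    intro s t s' f
    rw [Finset.sum_comm]
    rw [Finset.sum_congr rfl fun k _ => Finset.sum_comm, Finset.sum_comm]
    exact Finset.sum_congr rfl fun j _ => Finset.sum_comm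
  simp only [cumSum, Finset.sum_add_distrib]
  have h1 : ∑ i' ∈ Finset.Icc 1 (i - 1), ∑ k' ∈ Finset.Icc 1 r, ∑ j' ∈ Finset.Icc 1 (j - 1),
      ∑ l' ∈ Finset.Icc 1 r, a i' k' j' l' = ∑ j' ∈ Finset.Icc 1 (j - 1), ∑ l' ∈ Finset.Icc 1 r,
      ∑ i' ∈ Finset.Icc 1 (i - 1), ∑ k' ∈ Finset.Icc 1 r, a i' k' j' l' := by
    rw [hswap]
    exact Finset.sum_congr rfl fun j' _ => hswap _ _ _ _
  rw [h1, hswap _ _ (Finset.Icc 1 l), ← hswap (Finset.Icc 1 (j - 1)) (Finset.Icc 1 r)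
    (Finset.Icc 1 k) (fun j' l' k' => a i k' j' l'), Finset.sum_comm (s := Finset.Icc 1 k)]
  ring

lemma cumSum_const_mul (r : ℕ) (B : ℝ) (f : ℕ → ℕ → ℝ) (j l : ℕ) :
    cumSum r (fun j' l' => B * f j' l') j l = B * cumSum r f j l := by
  simp only [cumSum, ← Finset.mul_sum, mul_add]

lemma cumSum_congr {r n : ℕ} {f g : ℕ → ℕ → ℝ}
    (h : ∀ j ∈ Finset.Icc 1 n, ∀ l ∈ Finset.Icc 1 r, f j l = g j l) {j l : ℕ}
    (hj : j ∈ Finset.Icc 1 n) (hl : l ∈ Finset.Icc 1 r) : cumSum r f j l = cumSum r g j l := by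
  rw [Finset.mem_Icc] at hl
  have hj' := Finset.mem_Icc.mp hj
  rw [cumSum, cumSum]
  congr 1
  · refine Finset.sum_congr rfl fun j' hj'' => Finset.sum_congr rfl fun l' hl' => h j' ?_ l' hl'
    rw [Finset.mem_Icc] at hj'' ⊢
    omega
  · refine Finset.sum_congr rfl fun l' hl' => h j hj l' ?_
    rw [Finset.mem_Icc] at hl' ⊢
    omega

lemma cumSum_eq_zero {r n : ℕ} {f : ℕ → ℕ → ℝ}
    (h : ∀ j ∈ Finset.Icc 1 n, ∀ l ∈ Finset.Icc 1 r, f j l = 0) {j l : ℕ}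
    (hj : j ∈ Finset.Icc 1 n) (hl : l ∈ Finset.Icc 1 r) : cumSum r f j l = 0 := by
  rw [cumSum_congr (g := fun _ _ => 0) h hj hl]
  simp [cumSum]

/-- The discrete primitive in both directions of a family of double jumps. -/
def doublePrimitive (r : ℕ) (a : ℕ → ℕ → ℕ → ℕ → ℝ) (i k j l : ℕ) : ℝ :=
  cumSum r (fun i' k' => cumSum r (a i' k') j l) i k

lemma cumSum_sub_pred {r i k : ℕ} (hi : 1 ≤ i) (hk : 1 ≤ k) (f : ℕ → ℕ → ℝ) :
    cumSum r f i k - (if k - 1 = 0 ∧ i = 1 then 0 else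
      cumSum r f (if k - 1 = 0 then i - 1 else i) (if k - 1 = 0 then r else k - 1)) = f i k := by
  obtain ⟨k, rfl⟩ : ∃ k', k = k' + 1 := ⟨k - 1, by omega⟩
  simp only [Nat.add_sub_cancel]
  rcases Nat.eq_zero_or_pos k with rfl | hk0
  · by_cases h1 : i = 1
    · simp [h1, cumSum]
    · obtain ⟨i, rfl⟩ : ∃ i', i = i' + 2 := ⟨i - 2, by omega⟩
      simp only [true_and, if_true, if_neg h1, cumSum]
      rw [show i + 2 - 1 = i + 1 by omega, Finset.sum_Icc_succ_top (by omega),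
        Nat.add_sub_cancel]
      simp
  · simp only [hk0.ne', false_and, if_false, cumSum]
    rw [Finset.sum_Icc_succ_top (by omega)]
    ring

lemma jumpX_doublePrimitive {r i k j l : ℕ} (hi : 1 ≤ i) (hk : 1 ≤ k) (hl : 1 ≤ l)
    (a : ℕ → ℕ → ℕ → ℕ → ℝ) :
    jumpX r (doublePrimitive r a) i k j l = cumSum r (a i k) j l := by
  have hl' : l ≠ 0 := by omega
  have hk' : k ≠ 0 := by omega
  rw [jumpX, ← cumSum_sub_pred (r := r) hi hk (fun i' k' => cumSum r (a i' k') j l)]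
  simp [wE, doublePrimitive, hl', hk']

lemma jumpY_doublePrimitive {r i k j l : ℕ} (hj : 1 ≤ j) (hk : 1 ≤ k) (hl : 1 ≤ l)
    (a : ℕ → ℕ → ℕ → ℕ → ℝ) :
    jumpY r (doublePrimitive r a) i k j l = cumSum r (fun i' k' => a i' k' j l) i k := by
  have hl' : l ≠ 0 := by omega
  have hk' : k ≠ 0 := by omega
  have hcomm : doublePrimitive r a = fun i k j l =>
      cumSum r (fun j' l' => cumSum r (fun i' k' => a i' k' j' l') i k) j l := by
    funext i k j l
    exact cumSum_comm r a i k j l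
  rw [jumpY, hcomm,
    ← cumSum_sub_pred (r := r) hj hl (fun j' l' => cumSum r (fun i' k' => a i' k' j' l') i k)]
  simp [wE, hl', hk']

section Sums

variable {a b c d : ℝ} {r : ℕ} {P : RectPartition a b c d}

lemma sum_idxX (F : ℕ → ℕ → ℕ → ℕ → ℝ)
    (hF : ∀ i ∈ Finset.Icc 1 P.m, ∀ k ∈ Finset.Icc 1 r, F i k P.n r = 0) :
    ∑ q ∈ idxX r P, F q.1 q.2.1 q.2.2.1 q.2.2.2 =
      ∑ i ∈ Finset.Icc 1 P.m, ∑ k ∈ Finset.Icc 1 r, ∑ j ∈ Finset.Icc 1 P.n,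
        ∑ l ∈ Finset.Icc 1 r, F i k j l := by
  rw [idxX, Finset.sum_filter_of_ne]
  · simp only [Finset.sum_product]
  · rintro ⟨i, k, j, l⟩ hq hne ⟨rfl, rfl⟩
    simp only [Finset.mem_product] at hq
    exact hne (hF i hq.1 k hq.2.1)

lemma sum_idxY (F : ℕ → ℕ → ℕ → ℕ → ℝ)
    (hF : ∀ j ∈ Finset.Icc 1 P.n, ∀ l ∈ Finset.Icc 1 r, F P.m r j l = 0) :
    ∑ q ∈ idxY r P, F q.1 q.2.1 q.2.2.1 q.2.2.2 =
      ∑ j ∈ Finset.Icc 1 P.n, ∑ l ∈ Finset.Icc 1 r, ∑ i ∈ Finset.Icc 1 P.m,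
        ∑ k ∈ Finset.Icc 1 r, F i k j l := by
  rw [idxY, Finset.sum_filter_of_ne]
  · simp only [Finset.sum_product]
    rw [Finset.sum_congr rfl fun i _ => Finset.sum_comm, Finset.sum_comm]
    refine Finset.sum_congr rfl fun j _ => ?_
    rw [Finset.sum_congr rfl fun i _ => Finset.sum_comm, Finset.sum_comm]
  · rintro ⟨i, k, j, l⟩ hq hne ⟨rfl, rfl⟩
    simp only [Finset.mem_product] at hq
    exact hne (hF j hq.2.2.1 l hq.2.2.2)

end Sums

lemma IsBiPoly.exists_coeff {r : ℕ} {f : ℝ × ℝ → ℝ} (hf : IsBiPoly r f) :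
    ∃ e : ℕ → ℕ → ℝ, ∀ x y, f (x, y) = biEval r e x y := by
  obtain ⟨p, hp, hpc, hpe⟩ := hf
  refine ⟨fun a b => (p.coeff a).coeff b, fun x y => ?_⟩
  rw [hpe, evalXY, eval_eq_sum_range' (n := r + 1)
    (lt_of_le_of_lt (natDegree_map_le) (by omega)), biEval]
  refine Finset.sum_congr rfl fun a _ => ?_
  rw [coeff_map, coe_evalRingHom, eval_eq_sum_range' (n := r + 1) (by have := hpc a; omega),
    Finset.sum_mul]
  exact Finset.sum_congr rfl fun b _ => by ring

/-! ### The inf-sup condition -/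

/-- Coefficients of a piecewise polynomial after exchanging the two variables. -/
def swapCoeff (e : ℕ → ℕ → ℕ → ℕ → ℝ) (j i : ℕ) : ℕ → ℕ → ℝ := Function.swap (e i j)

/-- The test function whose double jumps are the Gauss weighted mixed derivatives. -/
noncomputable def gaussTestFun {a b c d : ℝ} (r : ℕ) (G A : ℕ → ℝ) (P : RectPartition a b c d)
    (e : ℕ → ℕ → ℕ → ℕ → ℝ) : ℕ → ℕ → ℕ → ℕ → ℝ :=
  doublePrimitive r fun i k j l => (P.x i - P.x (i - 1)) * A k / 2 *
    weightedDerivative r G A P.n P.y (fun j' => dxPoly r (e i j') (gridNode r G P.m P.x i k)) j l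

section InfSup

variable {a b c d : ℝ} {r : ℕ} {G A : ℕ → ℝ} {P : RectPartition a b c d}
  {e : ℕ → ℕ → ℕ → ℕ → ℝ} {v : PiecewiseFun P} {α : ℝ × ℝ → ℝ}

lemma lineJump_swapCoeff (i k j l : ℕ) :
    lineJump r G A P.n P.y P.m P.x (swapCoeff e) j l i k =
      cumSum r (fun i' k' => (P.x i' - P.x (i' - 1)) * A k' / 2 *
        weightedDerivative r G A P.n P.y
          (fun j' => dxPoly r (e i' j') (gridNode r G P.m P.x i' k')) j l) i k := by
  rw [lineJump, ← cumSum_const_mul]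
  congr 1
  funext i' k'
  rw [weightedDerivative, weightedDerivative, swapCoeff, dxPoly_derivative_swap]
  ring

lemma jumpX_gaussTestFun {i k j l : ℕ} (hi : 1 ≤ i) (hk : 1 ≤ k) (hl : 1 ≤ l) :
    jumpX r (gaussTestFun r G A P e) i k j l = lineJump r G A P.m P.x P.n P.y e i k j l := by
  rw [gaussTestFun, jumpX_doublePrimitive hi hk hl, lineJump, ← cumSum_const_mul]

lemma jumpY_gaussTestFun {i k j l : ℕ} (hj : 1 ≤ j) (hk : 1 ≤ k) (hl : 1 ≤ l) :
    jumpY r (gaussTestFun r G A P e) i k j l =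
      lineJump r G A P.n P.y P.m P.x (swapCoeff e) j l i k := by
  rw [gaussTestFun, jumpY_doublePrimitive hj hk hl, lineJump_swapCoeff]

lemma isTestFun_gaussTestFun (hr : 1 ≤ r) (hG : IsGaussPoints r G) (hA : IsGaussWeights r G A)
    (he : IsDxSpline r P.m P.x P.n P.y e) (he' : IsDxSpline r P.n P.y P.m P.x (swapCoeff e)) :
    IsTestFun r P (gaussTestFun r G A P e) := by
  have hrr : r ∈ Finset.Icc 1 r := Finset.mem_Icc.mpr ⟨hr, le_rfl⟩
  refine ⟨fun j hj l hl => ?_, fun i hi k hk => ?_⟩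
  · rw [gaussTestFun, doublePrimitive, cumSum_comm]
    refine cumSum_eq_zero (fun j' hj' l' hl' => ?_) hj hl
    rw [← lineJump_swapCoeff, he'.lineJump_last hr hG hA hj' hl']
  · refine cumSum_eq_zero (fun i' hi' k' hk' => ?_) hi hk
    rw [cumSum_const_mul]
    exact he.lineJump_last hr hG hA hi' hk'

lemma mem_idxX {q : ℕ × ℕ × ℕ × ℕ} (hq : q ∈ idxX r P) : q.1 ∈ Finset.Icc 1 P.m ∧
    q.2.1 ∈ Finset.Icc 1 r ∧ q.2.2.1 ∈ Finset.Icc 1 P.n ∧ q.2.2.2 ∈ Finset.Icc 1 r := by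
  simpa only [Finset.mem_product] using (Finset.mem_filter.mp hq).1

lemma mem_idxY {q : ℕ × ℕ × ℕ × ℕ} (hq : q ∈ idxY r P) : q.1 ∈ Finset.Icc 1 P.m ∧
    q.2.1 ∈ Finset.Icc 1 r ∧ q.2.2.1 ∈ Finset.Icc 1 P.n ∧ q.2.2.2 ∈ Finset.Icc 1 r := by
  simpa only [Finset.mem_product] using (Finset.mem_filter.mp hq).1

lemma aP_gaussTestFun (hr : 1 ≤ r) (hG : IsGaussPoints r G) (hA : IsGaussWeights r G A)
    (he : IsDxSpline r P.m P.x P.n P.y e) (he' : IsDxSpline r P.n P.y P.m P.x (swapCoeff e))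
    (Dx Dy : ℕ → ℕ → ℝ × ℝ → ℝ) :
    aP r G P α Dx Dy (gaussTestFun r G A P e) =
      (∑ i ∈ Finset.Icc 1 P.m, ∑ k ∈ Finset.Icc 1 r, ∑ j ∈ Finset.Icc 1 P.n,
        ∑ l ∈ Finset.Icc 1 r, lineJump r G A P.m P.x P.n P.y e i k j l *
          lineIntegral r G P.n P.y (fun t => α (gridNode r G P.m P.x i k, t))
            (fun j' t => Dx i j' (gridNode r G P.m P.x i k, t)) j l) +
      ∑ j ∈ Finset.Icc 1 P.n, ∑ l ∈ Finset.Icc 1 r, ∑ i ∈ Finset.Icc 1 P.m,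
        ∑ k ∈ Finset.Icc 1 r, lineJump r G A P.n P.y P.m P.x (swapCoeff e) j l i k *
          lineIntegral r G P.m P.x (fun t => α (t, gridNode r G P.n P.y j l))
            (fun i' t => Dy i' j (t, gridNode r G P.n P.y j l)) i k := by
  rw [← sum_idxX (P := P) (fun i k j l => lineJump r G A P.m P.x P.n P.y e i k j l *
          lineIntegral r G P.n P.y (fun t => α (gridNode r G P.m P.x i k, t))
            (fun j' t => Dx i j' (gridNode r G P.m P.x i k, t)) j l)
      (fun i hi k hk => by rw [he.lineJump_last hr hG hA hi hk, zero_mul]),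
    ← sum_idxY (P := P) (fun i k j l => lineJump r G A P.n P.y P.m P.x (swapCoeff e) j l i k *
          lineIntegral r G P.m P.x (fun t => α (t, gridNode r G P.n P.y j l))
            (fun i' t => Dy i' j (t, gridNode r G P.n P.y j l)) i k)
      (fun j hj l hl => by rw [he'.lineJump_last hr hG hA hj hl, zero_mul]), aP]
  congr 1
  · refine Finset.sum_congr rfl fun q hq => ?_
    obtain ⟨h1, h2, -, h4⟩ := mem_idxX hq
    rw [jumpX_gaussTestFun (Finset.mem_Icc.mp h1).1 (Finset.mem_Icc.mp h2).1
      (Finset.mem_Icc.mp h4).1]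
    rfl
  · refine Finset.sum_congr rfl fun q hq => ?_
    obtain ⟨-, h2, h3, h4⟩ := mem_idxY hq
    rw [jumpY_gaussTestFun (Finset.mem_Icc.mp h3).1 (Finset.mem_Icc.mp h2).1
      (Finset.mem_Icc.mp h4).1]
    rfl

lemma dualSemi_gaussTestFun (hr : 1 ≤ r) (hG : IsGaussPoints r G) (hA : IsGaussWeights r G A)
    (he : IsDxSpline r P.m P.x P.n P.y e) (he' : IsDxSpline r P.n P.y P.m P.x (swapCoeff e)) :
    dualSemi r P (gaussTestFun r G A P e) = Real.sqrt (
      (∑ i ∈ Finset.Icc 1 P.m, ∑ k ∈ Finset.Icc 1 r, ∑ j ∈ Finset.Icc 1 P.n,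
        ∑ l ∈ Finset.Icc 1 r, lineJump r G A P.m P.x P.n P.y e i k j l ^ 2) +
      ∑ j ∈ Finset.Icc 1 P.n, ∑ l ∈ Finset.Icc 1 r, ∑ i ∈ Finset.Icc 1 P.m,
        ∑ k ∈ Finset.Icc 1 r, lineJump r G A P.n P.y P.m P.x (swapCoeff e) j l i k ^ 2) := by
  rw [← sum_idxX (P := P) (fun i k j l => lineJump r G A P.m P.x P.n P.y e i k j l ^ 2)
      (fun i hi k hk => by rw [he.lineJump_last hr hG hA hi hk, zero_pow two_ne_zero]),
    ← sum_idxY (P := P)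
      (fun i k j l => lineJump r G A P.n P.y P.m P.x (swapCoeff e) j l i k ^ 2)
      (fun j hj l hl => by rw [he'.lineJump_last hr hG hA hj hl, zero_pow two_ne_zero]), dualSemi]
  congr 2
  · refine Finset.sum_congr rfl fun q hq => ?_
    obtain ⟨h1, h2, -, h4⟩ := mem_idxX hq
    rw [jumpX_gaussTestFun (Finset.mem_Icc.mp h1).1 (Finset.mem_Icc.mp h2).1
      (Finset.mem_Icc.mp h4).1]
  · refine Finset.sum_congr rfl fun q hq => ?_
    obtain ⟨-, h2, h3, h4⟩ := mem_idxY hq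
    rw [jumpY_gaussTestFun (Finset.mem_Icc.mp h3).1 (Finset.mem_Icc.mp h2).1
      (Finset.mem_Icc.mp h4).1]

lemma dualSemi_pos_of_aP_ne_zero {Dx Dy : ℕ → ℕ → ℝ × ℝ → ℝ} {w : ℕ → ℕ → ℕ → ℕ → ℝ}
    (h : aP r G P α Dx Dy w ≠ 0) : 0 < dualSemi r P w := by
  have hX : 0 ≤ ∑ q ∈ idxX r P, jumpX r w q.1 q.2.1 q.2.2.1 q.2.2.2 ^ 2 :=
    Finset.sum_nonneg fun _ _ => sq_nonneg _
  have hY : 0 ≤ ∑ q ∈ idxY r P, jumpY r w q.1 q.2.1 q.2.2.1 q.2.2.2 ^ 2 :=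
    Finset.sum_nonneg fun _ _ => sq_nonneg _
  refine Real.sqrt_pos.mpr (lt_of_le_of_ne (add_nonneg hX hY) fun h0 => h ?_)
  obtain ⟨hX0, hY0⟩ := (add_eq_zero_iff_of_nonneg hX hY).mp h0.symm
  rw [Finset.sum_eq_zero_iff_of_nonneg fun _ _ => sq_nonneg _] at hX0 hY0
  rw [aP, Finset.sum_eq_zero, Finset.sum_eq_zero, add_zero]
  · intro q hq
    rw [pow_eq_zero_iff two_ne_zero |>.mp (hY0 q hq), zero_mul]
  · intro q hq
    rw [pow_eq_zero_iff two_ne_zero |>.mp (hX0 q hq), zero_mul]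

lemma cellDx_eq {i j : ℕ} {e : ℕ → ℕ → ℝ} (h : v.cellFun i j = fun z => biEval r e z.1 z.2)
    (z : ℝ × ℝ) : cellDx v i j z = (dxPoly r e z.1).eval z.2 := by
  rw [cellDx, h, pdx, (fderiv_biEval r e z).1]

lemma cellDy_eq {i j : ℕ} {e : ℕ → ℕ → ℝ} (h : v.cellFun i j = fun z => biEval r e z.1 z.2)
    (z : ℝ × ℝ) : cellDy v i j z = (dxPoly r (Function.swap e) z.2).eval z.1 := by
  rw [cellDy, h, pdy, (fderiv_biEval r e z).2]

lemma integral_rect_swap (f : ℝ × ℝ → ℝ) (s t : Set ℝ) :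
    ∫ z in s ×ˢ t, f z.swap = ∫ z in t ×ˢ s, f z := by
  have hmp : MeasurePreserving (Prod.swap : ℝ × ℝ → ℝ × ℝ) volume volume :=
    Measure.measurePreserving_swap
  rw [← hmp.setIntegral_preimage_emb MeasurableEquiv.prodComm.measurableEmbedding f (t ×ˢ s),
    Set.preimage_swap_prod]

lemma semiH1_eq (hv : ∀ i ∈ Finset.Icc 1 P.m, ∀ j ∈ Finset.Icc 1 P.n,
      v.cellFun i j = fun z => biEval r (e i j) z.1 z.2) :
    semiH1 P v = Real.sqrt (dxEnergy r P.m P.x P.n P.y e +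
      dxEnergy r P.n P.y P.m P.x (swapCoeff e)) := by
  rw [semiH1, dxEnergy, dxEnergy, Finset.sum_comm (s := Finset.Icc 1 P.n)]
  simp only [← Finset.sum_add_distrib]
  congr 1
  refine Finset.sum_congr rfl fun i hi => Finset.sum_congr rfl fun j hj => ?_
  rw [← integral_rect_swap (fun z => (dxPoly r (swapCoeff e j i) z.1).eval z.2 ^ 2)]
  simp only [cellDx_eq (hv i hi j hj), cellDy_eq (hv i hi j hj), RectPartition.cell]
  refine integral_add (integrableOn_dxPoly_sq _ _ _ _ _) ?_
  have hc : Continuous fun z : ℝ × ℝ => (dxPoly r (Function.swap (e i j)) z.2).eval z.1 ^ 2 :=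
    ((continuous_dxPoly_eval r (Function.swap (e i j))).comp continuous_swap).pow 2
  exact hc.continuousOn.integrableOn_compact (isCompact_Icc.prod isCompact_Icc)

lemma IsTrialFun.exists_coeff (hv : IsTrialFun r P v) : ∃ e : ℕ → ℕ → ℕ → ℕ → ℝ,
    ∀ i ∈ Finset.Icc 1 P.m, ∀ j ∈ Finset.Icc 1 P.n,
      v.cellFun i j = fun z => biEval r (e i j) z.1 z.2 := by
  have h : ∀ i j, ∃ f : ℕ → ℕ → ℝ, i ∈ Finset.Icc 1 P.m → j ∈ Finset.Icc 1 P.n →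
      v.cellFun i j = fun z => biEval r f z.1 z.2 := by
    intro i j
    by_cases hi : i ∈ Finset.Icc 1 P.m
    · by_cases hj : j ∈ Finset.Icc 1 P.n
      · obtain ⟨f, hf⟩ := (hv.2.2 i hi j hj).exists_coeff
        exact ⟨f, fun _ _ => funext fun z => hf z.1 z.2⟩
      · exact ⟨0, fun _ h => absurd h hj⟩
    · exact ⟨0, fun h => absurd h hi⟩
  choose e he using h
  exact ⟨e, fun i hi j hj => he i j hi hj⟩

lemma PiecewiseConstant.exists_cell_values (hα : PiecewiseConstant P α) {α₀ : ℝ}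
    (hα₀ : ∀ z ∈ P.dom, α₀ ≤ α z) : ∃ κ : ℕ → ℕ → ℝ,
    (∀ i ∈ Finset.Icc 1 P.m, ∀ j ∈ Finset.Icc 1 P.n, ∀ s ∈ Set.Ioo (P.x (i - 1)) (P.x i),
      ∀ t ∈ Set.Ioo (P.y (j - 1)) (P.y j), α (s, t) = κ i j) ∧
    ∀ i ∈ Finset.Icc 1 P.m, ∀ j ∈ Finset.Icc 1 P.n, α₀ ≤ κ i j := by
  choose! κ hκ using hα
  refine ⟨κ, fun i hi j hj s hs t ht => hκ i hi j hj (s, t) ⟨hs, ht⟩, fun i hi j hj => ?_⟩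
  obtain ⟨s, hs⟩ := exists_between (pred_lt_of_mem_Icc P.hxlt hi)
  obtain ⟨t, ht⟩ := exists_between (pred_lt_of_mem_Icc P.hylt hj)
  rw [← hκ i hi j hj (s, t) ⟨hs, ht⟩]
  refine hα₀ _ ⟨?_, ?_⟩
  · have := grid_cell_subset P.hxlt hi ⟨hs.1.le, hs.2.le⟩
    rwa [P.hxa, P.hxb] at this
  · have := grid_cell_subset P.hylt hj ⟨ht.1.le, ht.2.le⟩
    rwa [P.hyc, P.hyd] at this

end InfSup

/-- The inf-sup condition: there is `c₀ = c₀(r, σ) > 0` such that for every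
`σ`-quasi-uniform partition, every piecewise constant `α ≥ α₀ > 0`, and every
nonzero trial function `v`, there is a test function `w ≠ 0` with
`a_P(v, w) ≥ c₀ α₀ |v|₁ |w|_{P'}`. -/
theorem fvm_inf_sup (r : ℕ) (hr : 1 ≤ r) (G A : ℕ → ℝ)
    (hG : IsGaussPoints r G) (hA : IsGaussWeights r G A) (σ : ℝ) (hσ : 1 ≤ σ) :
    ∃ c₀ : ℝ, 0 < c₀ ∧
      ∀ (a b c d : ℝ), a < b → c < d →
      ∀ P : RectPartition a b c d, P.QuasiUniform σ →
      ∀ (α : ℝ × ℝ → ℝ) (α₀ : ℝ), 0 < α₀ → PiecewiseConstant P α →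
        (∀ z ∈ P.dom, α₀ ≤ α z) →
      ∀ v : PiecewiseFun P, IsTrialFun r P v → (∃ z ∈ P.dom, v.toFun z ≠ 0) →
      ∃ w : ℕ → ℕ → ℕ → ℕ → ℝ, IsTestFun r P w ∧ 0 < dualSemi r P w ∧
        c₀ * α₀ * semiH1 P v * dualSemi r P w ≤ aP r G P α (cellDx v) (cellDy v) w := by
  obtain ⟨K, hK0, hK⟩ := exists_gaussPrimitive_sq_le r G A
  have hr0 : (0 : ℝ) < r := by exact_mod_cast hr
  have hσ0 : 0 < σ := by linarith
  have hC : 0 < (r : ℝ) * (σ * (2 * K)) := by positivity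
  set C : ℝ := (r : ℝ) * (σ * (2 * K))
  refine ⟨1 / Real.sqrt C, by positivity, ?_⟩
  intro a b c d hab hcd P hP α α₀ hα₀ hα hαge v hv hne
  obtain ⟨e, hve⟩ := hv.exists_coeff
  obtain ⟨κ, hακ, hκ⟩ := hα.exists_cell_values hαge
  have hu : ∀ i ∈ Finset.Icc 1 P.m, ∀ j ∈ Finset.Icc 1 P.n,
      ∀ s ∈ Set.Icc (P.x (i - 1)) (P.x i), ∀ t ∈ Set.Icc (P.y (j - 1)) (P.y j),
        biEval r (e i j) s t = v.toFun (s, t) := by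
    intro i hi j hj s hs t ht
    rw [← v.agree i hi j hj (s, t) ⟨hs, ht⟩, hve i hi j hj]
  have hu' : ∀ j ∈ Finset.Icc 1 P.n, ∀ i ∈ Finset.Icc 1 P.m,
      ∀ t ∈ Set.Icc (P.y (j - 1)) (P.y j), ∀ s ∈ Set.Icc (P.x (i - 1)) (P.x i),
        biEval r (swapCoeff e j i) t s = v.toFun (s, t) := by
    intro j hj i hi t ht s hs
    rw [swapCoeff, biEval_swap, hu i hi j hj s hs t ht]
  have hbx : ∀ s ∈ Set.Icc (P.x 0) (P.x P.m), v.toFun (s, P.y 0) = 0 ∧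
      v.toFun (s, P.y P.n) = 0 := by
    rw [P.hxa, P.hxb, P.hyc, P.hyd]
    exact fun s hs => ⟨hv.2.1 _ ⟨⟨hs, le_rfl, hcd.le⟩, fun h => h.2.1.false⟩,
      hv.2.1 _ ⟨⟨hs, hcd.le, le_rfl⟩, fun h => h.2.2.false⟩⟩
  have hby : ∀ t ∈ Set.Icc (P.y 0) (P.y P.n), v.toFun (P.x 0, t) = 0 ∧
      v.toFun (P.x P.m, t) = 0 := by
    rw [P.hxa, P.hxb, P.hyc, P.hyd]
    exact fun t ht => ⟨hv.2.1 _ ⟨⟨⟨le_rfl, hab.le⟩, ht⟩, fun h => h.1.1.false⟩,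
      hv.2.1 _ ⟨⟨⟨hab.le, le_rfl⟩, ht⟩, fun h => h.1.2.false⟩⟩
  have he : IsDxSpline r P.m P.x P.n P.y e :=
    isDxSpline_of_agree (u := fun s t => v.toFun (s, t)) P.hn P.hxlt P.hylt hu
      (fun s hs => (hbx s hs).1) (fun s hs => (hbx s hs).2)
  have he' : IsDxSpline r P.n P.y P.m P.x (swapCoeff e) :=
    isDxSpline_of_agree (u := fun t s => v.toFun (s, t)) P.hm P.hylt P.hxlt hu'
      (fun t ht => (hby t ht).1) (fun t ht => (hby t ht).2)
  set Ex := dxEnergy r P.m P.x P.n P.y e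
  set Ey := dxEnergy r P.n P.y P.m P.x (swapCoeff e)
  have hEy0 : 0 ≤ Ey := dxEnergy_nonneg
  have hEx0 : 0 < Ex := by
    refine lt_of_le_of_ne dxEnergy_nonneg fun h0 => ?_
    obtain ⟨⟨s, t⟩, ⟨hs, ht⟩, hst⟩ := hne
    have hs' : s ∈ Set.Icc (P.x 0) (P.x P.m) := by rwa [P.hxa, P.hxb]
    have ht' : t ∈ Set.Icc (P.y 0) (P.y P.n) := by rwa [P.hyc, P.hyd]
    exact hst (eq_zero_of_dxEnergy_eq_zero (u := fun s t => v.toFun (s, t)) P.hm P.hn P.hxlt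
      P.hylt hu (fun t ht => (hby t ht).1) h0.symm hs' ht')
  have haP : α₀ * (Ex + Ey) ≤ aP r G P α (cellDx v) (cellDy v) (gaussTestFun r G A P e) := by
    rw [aP_gaussTestFun hr hG hA he he', mul_add]
    refine add_le_add ?_ ?_
    · exact he.coercivity hr hG hA (f := fun s t => α (s, t))
        (D := fun i j s t => cellDx v i j (s, t)) hα₀.le hακ hκ
        fun i hi j hj s t => cellDx_eq (hve i hi j hj) (s, t)
    · exact he'.coercivity hr hG hA (f := fun t s => α (s, t)) (κ := fun j i => κ i j)
        (D := fun j i t s => cellDy v i j (s, t)) hα₀.le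
        (fun j hj i hi t ht s hs => hακ i hi j hj s hs t ht) (fun j hj i hi => hκ i hi j hj)
        fun j hj i hi t s => cellDy_eq (hve i hi j hj) (s, t)
  have hdual : dualSemi r P (gaussTestFun r G A P e) ≤ Real.sqrt C * Real.sqrt (Ex + Ey) := by
    rw [dualSemi_gaussTestFun hr hG hA he he', ← Real.sqrt_mul hC.le, mul_add]
    have hX : ∀ i ∈ Finset.Icc 1 P.m, P.hx i ∈ P.sides := fun i hi =>
      Finset.mem_union_left _ (Finset.mem_image_of_mem _ hi)
    have hY : ∀ j ∈ Finset.Icc 1 P.n, P.hy j ∈ P.sides := fun j hj =>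
      Finset.mem_union_right _ (Finset.mem_image_of_mem _ hj)
    refine Real.sqrt_le_sqrt (add_le_add ?_ ?_)
    · exact he.sum_lineJump_sq_le hr hG hA hσ0.le hK
        fun i hi j hj => hP _ (hX i hi) _ (hY j hj)
    · exact he'.sum_lineJump_sq_le hr hG hA hσ0.le hK
        fun j hj i hi => hP _ (hY j hj) _ (hX i hi)
  have hE : 0 < Ex + Ey := by positivity
  refine ⟨gaussTestFun r G A P e, isTestFun_gaussTestFun hr hG hA he he',
    dualSemi_pos_of_aP_ne_zero (lt_of_lt_of_le (mul_pos hα₀ hE) haP).ne', le_trans ?_ haP⟩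
  rw [semiH1_eq hve]
  calc 1 / Real.sqrt C * α₀ * Real.sqrt (Ex + Ey) * dualSemi r P (gaussTestFun r G A P e)
      ≤ 1 / Real.sqrt C * α₀ * Real.sqrt (Ex + Ey) *
          (Real.sqrt C * Real.sqrt (Ex + Ey)) := by gcongr
    _ = α₀ * (Real.sqrt (Ex + Ey) * Real.sqrt (Ex + Ey)) := by
      have := (Real.sqrt_pos.mpr hC).ne'
      field_simp
    _ = α₀ * (Ex + Ey) := by rw [Real.mul_self_sqrt hE.le]
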